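/- Fix a constant β ≥ 3 and consider non-uniform random 2-SAT with the power-law ensemble pᵢ = (n/i)^{1/(β−1)} / Σ_{j=1}^n (n/j)^{1/(β−1)}. Then p₁² = o(Σ_{i=1}^n pᵢ²), and there is a sharp satisfiability threshold: for β > 3 the threshold is at m*(n) = (1±o(1))·((β−3)(β−1)/(β−2)²)·n, and for β = 3 it is at m*(n) = (1±o(1))·4n/ln n; that is, for every constant ε > 0, Pr(Φ satisfiable) = 1−o(1) if m(n) ≤ (1−ε)·m*(n) and Pr(Φ satisfiable) = o(1) if m(n) ≥ (1+ε)·m*(n). -/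

import Mathlib

open Finset Filter Asymptotics

open scoped Classical

/-- The probability of drawing a given ordered 2-clause (an ordered pair of literals over
distinct variables); an unordered 2-clause over variables `i ≠ j` then has total probability
`(C/2)·pᵢ·pⱼ` where `C = (1 - ∑ pᵢ²)⁻¹`. -/
noncomputable def clauseProb2 (n : ℕ) (p : ℕ → ℝ) (c : (Fin n × Bool) × (Fin n × Bool)) : ℝ :=
  if c.1.1 ≠ c.2.1 then
    (1 - ∑ i ∈ Finset.range n, p i ^ 2)⁻¹ / 4 * p c.1.1.1 * p c.2.1.1
  else 0

/-- The probability of drawing a given formula: `m` clauses drawn independently. -/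
noncomputable def formulaProb2 (n m : ℕ) (p : ℕ → ℝ)
    (Φ : Fin m → (Fin n × Bool) × (Fin n × Bool)) : ℝ :=
  ∏ j, clauseProb2 n p (Φ j)

/-- Satisfiability of a 2-CNF formula: a literal `(x, b)` is satisfied by an assignment `a`
iff `a x = b`. -/
def Sat2 {n m : ℕ} (Φ : Fin m → (Fin n × Bool) × (Fin n × Bool)) : Prop :=
  ∃ a : Fin n → Bool, ∀ j, a (Φ j).1.1 = (Φ j).1.2 ∨ a (Φ j).2.1 = (Φ j).2.2

/-- The probability that a non-uniform random 2-SAT formula with `n` variables, `m` clauses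
and variable distribution `p` is satisfiable. -/
noncomputable def probSat2 (n m : ℕ) (p : ℕ → ℝ) : ℝ :=
  ∑ Φ : Fin m → (Fin n × Bool) × (Fin n × Bool),
    if Sat2 Φ then formulaProb2 n m p Φ else 0

/-- The probability that a non-uniform random 2-SAT formula is unsatisfiable. -/
noncomputable def probUnsat2 (n m : ℕ) (p : ℕ → ℝ) : ℝ :=
  ∑ Φ : Fin m → (Fin n × Bool) × (Fin n × Bool),
    if ¬ Sat2 Φ then formulaProb2 n m p Φ else 0

/-- The normalization constant `C = (1 - ∑ pᵢ²)⁻¹`. -/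
noncomputable def Cconst (n : ℕ) (p : ℕ → ℝ) : ℝ :=
  (1 - ∑ i ∈ Finset.range n, p i ^ 2)⁻¹

/-- The maximum clause probability `q_max = (C/2)·p₁·p₂`. -/
noncomputable def qmax2 (n : ℕ) (p : ℕ → ℝ) : ℝ :=
  Cconst n p / 2 * p 0 * p 1

/-- `p n` is a probability vector on `n` variables (indexed `0,…,n-1`), sorted decreasingly,
with all entries positive. -/
def ProbEnsemble (p : ℕ → ℕ → ℝ) : Prop :=
  ∀ n, 1 ≤ n →
    (∑ i ∈ Finset.range n, p n i = 1) ∧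
    (∀ i j, i ≤ j → j < n → p n j ≤ p n i) ∧
    (∀ i, i < n → 0 < p n i)

/-- The power-law normalization sum `∑_{j=1}^n (n/j)^{1/(β-1)}`. -/
noncomputable def plSum (β : ℝ) (n : ℕ) : ℝ :=
  ∑ j ∈ Finset.range n, ((n : ℝ) / (j + 1)) ^ ((1 : ℝ) / (β - 1))

/-- The power-law probability `pᵢ = (n/i)^{1/(β-1)} / ∑_{j=1}^n (n/j)^{1/(β-1)}`
(`i` runs over `0,…,n-1`, corresponding to the paper's `1,…,n`). -/
noncomputable def plProb (β : ℝ) (n i : ℕ) : ℝ :=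
  ((n : ℝ) / (i + 1)) ^ ((1 : ℝ) / (β - 1)) / plSum β n

section Abstract

variable {K : Type*} [Fintype K] [DecidableEq K]

lemma sum_prod_pi (m : ℕ) (F : Fin m → K → ℝ) :
    ∑ Φ : Fin m → K, ∏ j, F j (Φ j) = ∏ j, ∑ c, F j c := by
  rw [Finset.prod_univ_sum, Fintype.piFinset_univ]

lemma fiber_cases {ι : Type*} [Fintype ι] {m : ℕ} (f : ι → Fin m) (hf : Function.Injective f)
    (j : Fin m) : (univ.filter (fun e => f e = j)) = ∅ ∨
      ∃ e, f e = j ∧ (univ.filter (fun e => f e = j)) = {e} := by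
  by_cases h : ∃ e, f e = j
  · right
    obtain ⟨e, he⟩ := h
    refine ⟨e, he, ?_⟩
    ext e'
    simp only [mem_filter, mem_univ, true_and, mem_singleton]
    constructor
    · intro h'; exact hf (h'.trans he.symm)
    · rintro rfl; exact he
  · left
    push Not at h
    ext e'
    simp [h e']

lemma prod_fib {ι : Type*} [Fintype ι] {m : ℕ} (f : ι → Fin m) (g : ι → Fin m → ℝ) :
    ∏ e, g e (f e) = ∏ j, ∏ e ∈ univ.filter (fun e => f e = j), g e j := by
  rw [← Finset.prod_fiberwise univ f]
  refine prod_congr rfl fun j _ => prod_congr rfl fun e he => ?_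
  simp only [mem_filter, mem_univ, true_and] at he
  rw [he]

lemma single_prob {ι : Type*} [Fintype ι] {m : ℕ} (μ : K → ℝ) (h1 : ∑ c, μ c = 1)
    (B : ι → Finset K) (f : ι → Fin m) (hf : Function.Injective f) :
    ∑ Φ : Fin m → K, (∏ j, μ (Φ j)) * (∏ e, if Φ (f e) ∈ B e then (1:ℝ) else 0)
      = ∏ e, ∑ c ∈ B e, μ c := by
  have e1 : ∀ Φ : Fin m → K, (∏ j, μ (Φ j)) * (∏ e, if Φ (f e) ∈ B e then (1:ℝ) else 0)
      = ∏ j, (μ (Φ j) * ∏ e ∈ univ.filter (fun e => f e = j), if Φ j ∈ B e then (1:ℝ) else 0) := by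
    intro Φ
    rw [prod_fib f (fun e j => if Φ j ∈ B e then (1:ℝ) else 0), ← prod_mul_distrib]
  simp_rw [e1]
  rw [sum_prod_pi m (fun j c => μ c * ∏ e ∈ univ.filter (fun e => f e = j),
    if c ∈ B e then (1:ℝ) else 0), prod_fib f (fun e _ => ∑ c ∈ B e, μ c)]
  refine prod_congr rfl fun j _ => ?_
  rcases fiber_cases f hf j with h | ⟨e, he, h⟩
  · simp [h, h1]
  · simp [h]

lemma pair_prob {ι : Type*} [Fintype ι] {m : ℕ} (μ : K → ℝ) (h0 : ∀ c, 0 ≤ μ c)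
    (h1 : ∑ c, μ c = 1)
    (B B' : ι → Finset K) (hB : ∀ e e', B e = B' e' ∨ Disjoint (B e) (B' e'))
    (f f' : ι → Fin m) (hf : Function.Injective f) (hf' : Function.Injective f') :
    ∑ Φ : Fin m → K, (∏ j, μ (Φ j)) * (∏ e, if Φ (f e) ∈ B e then (1:ℝ) else 0)
      * (∏ e, if Φ (f' e) ∈ B' e then (1:ℝ) else 0)
      ≤ (∏ e, ∑ c ∈ B e, μ c) *
        ∏ e', ((∑ c ∈ B' e', μ c) + ∑ e, if f e = f' e' ∧ B e = B' e' then (1:ℝ) else 0) := by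
  have e1 : ∀ Φ : Fin m → K, (∏ j, μ (Φ j)) * (∏ e, if Φ (f e) ∈ B e then (1:ℝ) else 0)
      * (∏ e, if Φ (f' e) ∈ B' e then (1:ℝ) else 0)
      = ∏ j, (μ (Φ j) * (∏ e ∈ univ.filter (fun e => f e = j), if Φ j ∈ B e then (1:ℝ) else 0) *
        ∏ e ∈ univ.filter (fun e => f' e = j), if Φ j ∈ B' e then (1:ℝ) else 0) := by
    intro Φ
    rw [prod_fib f (fun e j => if Φ j ∈ B e then (1:ℝ) else 0),
      prod_fib f' (fun e j => if Φ j ∈ B' e then (1:ℝ) else 0),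
      ← prod_mul_distrib, ← prod_mul_distrib]
  simp_rw [e1]
  rw [sum_prod_pi m (fun j c => μ c * (∏ e ∈ univ.filter (fun e => f e = j),
    if c ∈ B e then (1:ℝ) else 0) * ∏ e ∈ univ.filter (fun e => f' e = j),
    if c ∈ B' e then (1:ℝ) else 0), prod_fib f (fun e _ => ∑ c ∈ B e, μ c),
    prod_fib f' (fun e' j => (∑ c ∈ B' e', μ c) +
      ∑ e, if f e = j ∧ B e = B' e' then (1:ℝ) else 0), ← prod_mul_distrib]
  have hM : ∀ s : Finset K, 0 ≤ ∑ c ∈ s, μ c := fun s => sum_nonneg fun c _ => h0 c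
  refine prod_le_prod (fun j _ => ?_) fun j _ => ?_
  · refine sum_nonneg fun c _ => mul_nonneg (mul_nonneg (h0 c) ?_) ?_
    · exact prod_nonneg fun e _ => by split_ifs <;> norm_num
    · exact prod_nonneg fun e _ => by split_ifs <;> norm_num
  have hS : ∀ (e' : ι), 0 ≤ ∑ e, if f e = j ∧ B e = B' e' then (1:ℝ) else 0 := fun e' =>
    sum_nonneg fun e _ => by split_ifs <;> norm_num
  rcases fiber_cases f hf j with h | ⟨e, he, h⟩ <;>
    rcases fiber_cases f' hf' j with h' | ⟨e', he', h'⟩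
  · simp [h, h', h1]
  · simp only [h, h', prod_empty, mul_one, prod_singleton, mul_ite, mul_zero, one_mul]
    rw [← Finset.sum_filter, Finset.filter_mem_eq_inter, univ_inter]
    linarith [hS e']
  · simp [h, h']
  · simp only [h, h', prod_singleton]
    rcases hB e e' with hb | hb
    · have : (1:ℝ) ≤ ∑ e, if f e = j ∧ B e = B' e' then (1:ℝ) else 0 := by
        refine le_trans ?_ (single_le_sum (f := fun e => if f e = j ∧ B e = B' e' then (1:ℝ) else 0)
          (fun i _ => by split_ifs <;> norm_num) (mem_univ e))
        simp [he, hb]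
      calc ∑ c, (μ c * if c ∈ B e then (1:ℝ) else 0) * (if c ∈ B' e' then (1:ℝ) else 0)
          = ∑ c ∈ B e, μ c := by simp [hb]
        _ = (∑ c ∈ B e, μ c) * 1 := by ring
        _ ≤ _ := by
          apply mul_le_mul_of_nonneg_left _ (hM _)
          linarith [hM (B' e')]
    · calc ∑ c, (μ c * if c ∈ B e then (1:ℝ) else 0) * (if c ∈ B' e' then (1:ℝ) else 0)
          = ∑ c : K, (0:ℝ) := by
            refine sum_congr rfl fun c _ => ?_
            by_cases hc : c ∈ B e
            · have := Finset.disjoint_left.mp hb hc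
              simp [this]
            · simp [hc]
        _ = 0 := by simp
        _ ≤ _ := mul_nonneg (hM _) (add_nonneg (hM _) (hS _))

lemma first_moment {ι T : Type*} [Fintype ι] [Fintype T] {m : ℕ} (μ : K → ℝ) (h0 : ∀ c, 0 ≤ μ c)
    (h1 : ∑ c, μ c = 1) (B : T → ι → Finset K) :
    (∑ Φ : Fin m → K, if ∃ τ, ∃ f : ι → Fin m, Function.Injective f ∧ ∀ e, Φ (f e) ∈ B τ e
      then ∏ j, μ (Φ j) else 0) ≤ ∑ τ, (m:ℝ) ^ (Fintype.card ι) * ∏ e, ∑ c ∈ B τ e, μ c := by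
  have hM : ∀ s : Finset K, 0 ≤ ∑ c ∈ s, μ c := fun s => sum_nonneg fun c _ => h0 c
  have step : ∀ Φ : Fin m → K, (if ∃ τ, ∃ f : ι → Fin m, Function.Injective f ∧
      ∀ e, Φ (f e) ∈ B τ e then ∏ j, μ (Φ j) else 0) ≤
      ∑ τ, ∑ f ∈ univ.filter (fun f : ι → Fin m => Function.Injective f),
        (∏ j, μ (Φ j)) * (∏ e, if Φ (f e) ∈ B τ e then (1:ℝ) else 0) := by
    intro Φ
    have hp : 0 ≤ ∏ j, μ (Φ j) := prod_nonneg fun j _ => h0 _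
    have hn : ∀ (τ : T) (f : ι → Fin m), 0 ≤ (∏ j, μ (Φ j)) * (∏ e : ι, if Φ (f e) ∈ B τ e then (1:ℝ) else 0) :=
      fun τ f => mul_nonneg hp (prod_nonneg fun e _ => by split_ifs <;> norm_num)
    split_ifs with h
    · obtain ⟨τ, f, hf, hh⟩ := h
      have hfm : f ∈ univ.filter (fun f : ι → Fin m => Function.Injective f) :=
        mem_filter.mpr ⟨mem_univ _, hf⟩
      have a1 := single_le_sum (f := fun f : ι → Fin m =>
        (∏ j, μ (Φ j)) * (∏ e, if Φ (f e) ∈ B τ e then (1:ℝ) else 0))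
        (fun f _ => hn τ f) hfm
      have a2 := single_le_sum (f := fun τ => ∑ f ∈ univ.filter
        (fun f : ι → Fin m => Function.Injective f),
        (∏ j, μ (Φ j)) * (∏ e, if Φ (f e) ∈ B τ e then (1:ℝ) else 0))
        (fun τ _ => sum_nonneg fun f _ => hn τ f) (mem_univ τ)
      refine le_trans (le_of_eq ?_) (a1.trans a2)
      simp only [hh, if_true, prod_const_one, mul_one]
    · exact sum_nonneg fun τ _ => sum_nonneg fun f _ => hn τ f
  refine (sum_le_sum fun Φ _ => step Φ).trans ?_
  rw [sum_comm]
  refine sum_le_sum fun τ _ => ?_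
  rw [sum_comm]
  calc _ = ∑ f ∈ univ.filter (fun f : ι → Fin m => Function.Injective f),
        ∏ e, ∑ c ∈ B τ e, μ c := by
        refine sum_congr rfl fun f hf => ?_
        exact single_prob μ h1 (B τ) f (by simpa using hf)
    _ ≤ ∑ f : ι → Fin m, ∏ e, ∑ c ∈ B τ e, μ c :=
        sum_le_sum_of_subset_of_nonneg (filter_subset _ _)
          fun f _ _ => prod_nonneg fun e _ => hM _
    _ = _ := by simp

lemma second_moment {ι T : Type*} [Fintype ι] (S : Finset T) {m : ℕ} (μ : K → ℝ)
    (h0 : ∀ c, 0 ≤ μ c) (h1 : ∑ c, μ c = 1) (B : T → ι → Finset K)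
    (hB : ∀ τ ∈ S, ∀ τ' ∈ S, ∀ e e', B τ e = B τ' e' ∨ Disjoint (B τ e) (B τ' e'))
    (D : ℝ)
    (hD : ∀ τ ∈ S, ∑ τ' ∈ S, ∏ e', ((m:ℝ) * (∑ c ∈ B τ' e', μ c) +
      ∑ e, if B τ e = B τ' e' then (1:ℝ) else 0) ≤ D) :
    (m.descFactorial (Fintype.card ι) : ℝ) * ∑ τ ∈ S, ∏ e, ∑ c ∈ B τ e, μ c ≤
    D * (∑ Φ : Fin m → K, if ∃ τ ∈ S, ∃ f : ι → Fin m, ∀ e, Φ (f e) ∈ B τ e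
      then ∏ j, μ (Φ j) else 0) := by
  have hM : ∀ s : Finset K, 0 ≤ ∑ c ∈ s, μ c := fun s => sum_nonneg fun c _ => h0 c
  set J : Finset (ι → Fin m) := univ.filter (fun f : ι → Fin m => Function.Injective f) with hJ
  set W : (Fin m → K) → ℝ := fun Φ => ∏ j, μ (Φ j) with hW
  have hW0 : ∀ Φ, 0 ≤ W Φ := fun Φ => prod_nonneg fun j _ => h0 _
  set I : T → (ι → Fin m) → (Fin m → K) → ℝ := fun τ f Φ =>
    ∏ e, if Φ (f e) ∈ B τ e then (1:ℝ) else 0 with hI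
  set X : (Fin m → K) → ℝ := fun Φ => ∑ τ ∈ S, ∑ f ∈ J, I τ f Φ with hX
  set N : ℝ := (m.descFactorial (Fintype.card ι) : ℝ) * ∑ τ ∈ S, ∏ e, ∑ c ∈ B τ e, μ c with hN
  set P := (∑ Φ : Fin m → K, if ∃ τ ∈ S, ∃ f : ι → Fin m, ∀ e, Φ (f e) ∈ B τ e
      then ∏ j, μ (Φ j) else 0) with hP
  have hP0 : 0 ≤ P := sum_nonneg fun Φ _ => by
    split_ifs
    · exact hW0 Φ
    · exact le_rfl
  have hN0 : 0 ≤ N := mul_nonneg (by positivity) (sum_nonneg fun τ _ => prod_nonneg fun e _ => hM _)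
  have hJc : (J.card : ℝ) = (m.descFactorial (Fintype.card ι) : ℝ) := by
    have : J.card = Fintype.card (ι ↪ Fin m) := by
      rw [hJ, ← Fintype.card_subtype]
      exact Fintype.card_congr (Equiv.subtypeInjectiveEquivEmbedding ι (Fin m))
    rw [this, Fintype.card_embedding_eq, Fintype.card_fin]
  have hEX : ∑ Φ, W Φ * X Φ = N := by
    simp_rw [hX, mul_sum]
    rw [sum_comm, hN, mul_sum]
    refine sum_congr rfl fun τ _ => ?_
    rw [sum_comm, ← hJc, ← nsmul_eq_mul, ← sum_const]
    refine sum_congr rfl fun f hf => ?_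
    exact single_prob μ h1 (B τ) f (by simpa [hJ] using hf)
  have hEX2 : ∑ Φ, W Φ * X Φ ^ 2 ≤ N * D := by
    have : ∀ Φ, W Φ * X Φ ^ 2 = ∑ τ ∈ S, ∑ f ∈ J, ∑ τ' ∈ S, ∑ f' ∈ J, W Φ * I τ f Φ * I τ' f' Φ := by
      intro Φ
      rw [sq, ← mul_assoc]
      simp_rw [hX, mul_sum, sum_mul]
      refine sum_congr rfl fun τ _ => sum_congr rfl fun f _ => sum_congr rfl fun τ' _ =>
        sum_congr rfl fun f' _ => ?_
      ring
    simp_rw [this]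
    rw [sum_comm, hN, mul_comm (m.descFactorial _ : ℝ), sum_mul, sum_mul]
    refine sum_le_sum fun τ hτ => ?_
    rw [sum_comm, mul_assoc, mul_comm, mul_assoc, ← hJc, ← nsmul_eq_mul, ← sum_const]
    refine sum_le_sum fun f hf => ?_
    rw [sum_comm, mul_comm]
    have hf1 : Function.Injective f := by simpa [hJ] using hf
    calc _ ≤ ∑ τ' ∈ S, ∑ f' ∈ J, (∏ e, ∑ c ∈ B τ e, μ c) *
        ∏ e', ((∑ c ∈ B τ' e', μ c) + ∑ e, if f e = f' e' ∧ B τ e = B τ' e' then (1:ℝ) else 0) := by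
          refine sum_le_sum fun τ' hτ' => ?_
          rw [sum_comm]
          refine sum_le_sum fun f' hf' => ?_
          exact pair_prob μ h0 h1 (B τ) (B τ') (hB τ hτ τ' hτ') f f' hf1 (by simpa [hJ] using hf')
      _ ≤ ∑ τ' ∈ S, (∏ e, ∑ c ∈ B τ e, μ c) * ∏ e', ((m:ℝ) * (∑ c ∈ B τ' e', μ c) +
          ∑ e, if B τ e = B τ' e' then (1:ℝ) else 0) := by
          refine sum_le_sum fun τ' hτ' => ?_
          rw [← mul_sum]
          refine mul_le_mul_of_nonneg_left ?_ (prod_nonneg fun e _ => hM _)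
          calc _ ≤ ∑ f' : ι → Fin m, ∏ e', ((∑ c ∈ B τ' e', μ c) +
                ∑ e, if f e = f' e' ∧ B τ e = B τ' e' then (1:ℝ) else 0) := by
                refine sum_le_sum_of_subset_of_nonneg (filter_subset _ _) fun f' _ _ => ?_
                refine prod_nonneg fun e _ => add_nonneg (hM _) (sum_nonneg fun e _ => ?_)
                split_ifs <;> norm_num
            _ = ∏ e', ∑ j : Fin m, ((∑ c ∈ B τ' e', μ c) +
                ∑ e, if f e = j ∧ B τ e = B τ' e' then (1:ℝ) else 0) := by
                rw [Finset.prod_univ_sum, Fintype.piFinset_univ]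
            _ = _ := by
                refine prod_congr rfl fun e' _ => ?_
                rw [sum_add_distrib]
                congr 1
                · simp
                · rw [sum_comm]
                  refine sum_congr rfl fun e _ => ?_
                  by_cases hb : B τ e = B τ' e' <;> simp [hb]
      _ ≤ _ := by
          rw [← mul_sum]
          exact mul_le_mul_of_nonneg_left (hD τ hτ) (prod_nonneg fun e _ => hM _)
  have hCS : N ^ 2 ≤ P * (N * D) := by
    refine le_trans ?_ (mul_le_mul_of_nonneg_left hEX2 hP0)
    rw [← hEX]
    have := Finset.sum_sq_le_sum_mul_sum_of_sq_le_mul (univ : Finset (Fin m → K))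
      (r := fun Φ => W Φ * X Φ) (f := fun Φ => if ∃ τ ∈ S, ∃ f : ι → Fin m, ∀ e, Φ (f e) ∈ B τ e
      then ∏ j, μ (Φ j) else 0) (g := fun Φ => W Φ * X Φ ^ 2) ?_ ?_ ?_
    · exact this
    · intro Φ _
      split_ifs
      · exact hW0 Φ
      · exact le_rfl
    · intro Φ _
      exact mul_nonneg (hW0 Φ) (sq_nonneg _)
    · intro Φ _
      split_ifs with h
      · apply le_of_eq; ring
      · have : X Φ = 0 := by
          refine sum_eq_zero fun τ hτ => sum_eq_zero fun f _ => ?_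
          have h2 : ¬ ∀ e, Φ (f e) ∈ B τ e := fun hh => h ⟨τ, hτ, f, hh⟩
          push Not at h2
          obtain ⟨e, he⟩ := h2
          exact prod_eq_zero (mem_univ e) (by simp [he])
        simp [this]
  rcases hN0.eq_or_lt with h | h
  · rw [← h]
    by_cases hS : S.Nonempty
    · obtain ⟨τ, hτ⟩ := hS
      refine mul_nonneg (le_trans ?_ (hD τ hτ)) hP0
      refine sum_nonneg fun τ' _ => prod_nonneg fun e _ => add_nonneg (mul_nonneg (by positivity) (hM _))
        (sum_nonneg fun e _ => ?_)
      split_ifs <;> norm_num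
    · rw [not_nonempty_iff_eq_empty] at hS
      have : P = 0 := by simp [hP, hS]
      simp [this]
  · have : N * N ≤ N * (D * P) := by nlinarith
    exact le_of_mul_le_mul_left this h

end Abstract

/-- Literals. -/
abbrev Lit (n : ℕ) := Fin n × Bool

/-- Negation of a literal. -/
def ng {n : ℕ} (a : Lit n) : Lit n := (a.1, !a.2)

@[simp] lemma ng_ng {n : ℕ} (a : Lit n) : ng (ng a) = a := by simp [ng]
@[simp] lemma ng_fst {n : ℕ} (a : Lit n) : (ng a).1 = a.1 := rfl
lemma ng_ne {n : ℕ} (a : Lit n) : ng a ≠ a := by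
  intro h; have := congrArg Prod.snd h; simp [ng] at this
lemma ng_inj {n : ℕ} {a b : Lit n} (h : ng a = ng b) : a = b := by
  rw [← ng_ng a, h, ng_ng]
lemma eq_or_ng {n : ℕ} {a b : Lit n} (h : a.1 = b.1) : a = b ∨ a = ng b := by
  rcases a with ⟨x, s⟩; rcases b with ⟨y, t⟩
  simp only at h; subst h
  cases s <;> cases t <;> simp [ng]

/-- The set of ordered clauses encoding the implication `a → b`. -/
def Bs {n : ℕ} (a b : Lit n) : Finset (Lit n × Lit n) := {(ng a, b), (b, ng a)}

lemma Bs_both {n : ℕ} {a b a' b' : Lit n} {c : Lit n × Lit n} (h : c ∈ Bs a b) (h' : c ∈ Bs a' b') :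
    (a = a' ∧ b = b') ∨ (a = ng b' ∧ b = ng a') := by
  simp only [Bs, mem_insert, mem_singleton] at h h'
  rcases h with rfl | rfl <;> rcases h' with h' | h' <;> simp only [Prod.mk.injEq] at h'
  · left; exact ⟨ng_inj h'.1, h'.2⟩
  · right; exact ⟨by rw [← h'.1, ng_ng], h'.2⟩
  · right; exact ⟨by rw [← h'.2, ng_ng], h'.1⟩
  · left; exact ⟨ng_inj h'.2, h'.1⟩

lemma Bs_symm {n : ℕ} (a b : Lit n) : Bs (ng b) (ng a) = Bs a b := by
  ext c; simp [Bs, or_comm]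

lemma Bs_eq {n : ℕ} {a b a' b' : Lit n} (h : Bs a b = Bs a' b') :
    (a = a' ∧ b = b') ∨ (a = ng b' ∧ b = ng a') := by
  have : (ng a, b) ∈ Bs a b := by simp [Bs]
  exact Bs_both this (h ▸ this)

lemma Bs_eq_or_disj {n : ℕ} (a b a' b' : Lit n) : Bs a b = Bs a' b' ∨ Disjoint (Bs a b) (Bs a' b') := by
  by_cases h : ∃ c, c ∈ Bs a b ∧ c ∈ Bs a' b'
  · left
    obtain ⟨c, h1, h2⟩ := h
    rcases Bs_both h1 h2 with ⟨rfl, rfl⟩ | ⟨rfl, rfl⟩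
    · rfl
    · exact Bs_symm _ _
  · right
    rw [Finset.disjoint_left]
    intro c h1 h2
    exact h ⟨c, h1, h2⟩

section clause
variable {n : ℕ} {p : ℕ → ℝ}

lemma clauseProb_nonneg (hp : ∀ i, i < n → 0 ≤ p i) (hs : ∑ i ∈ range n, p i ^ 2 < 1)
    (c : Lit n × Lit n) : 0 ≤ clauseProb2 n p c := by
  unfold clauseProb2
  split_ifs
  · have h1 := hp _ c.1.1.2
    have h2 := hp _ c.2.1.2
    have : 0 ≤ (1 - ∑ i ∈ range n, p i ^ 2)⁻¹ := inv_nonneg.mpr (by linarith)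
    positivity
  · exact le_rfl

lemma clauseProb_sum (h1 : ∑ i ∈ range n, p i = 1) (hs : ∑ i ∈ range n, p i ^ 2 < 1) :
    ∑ c : Lit n × Lit n, clauseProb2 n p c = 1 := by
  have hne : (1 - ∑ i ∈ range n, p i ^ 2) ≠ 0 := by linarith
  set s := ∑ i ∈ range n, p i ^ 2 with hsdef
  have e1 : ∑ i : Fin n, p i = 1 := by rw [← h1, Finset.sum_range]
  have e2 : ∑ i : Fin n, p i ^ 2 = s := by rw [hsdef, Finset.sum_range]
  have key : ∀ i : Fin n, ∑ j : Fin n, (if i ≠ j then (1 - s)⁻¹ / 4 * p i * p j else 0)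
      = (1 - s)⁻¹ / 4 * p i * 1 - (1 - s)⁻¹ / 4 * p i ^ 2 := by
    intro i
    have : ∀ j : Fin n, (if i ≠ j then (1 - s)⁻¹ / 4 * p i * p j else 0)
        = (1 - s)⁻¹ / 4 * p i * p j - (if i = j then (1 - s)⁻¹ / 4 * p i * p j else 0) := by
      intro j
      by_cases h : i = j <;> simp [h]
    simp_rw [this]
    rw [sum_sub_distrib, ← mul_sum, e1]
    simp
    ring
  calc ∑ c : Lit n × Lit n, clauseProb2 n p c
      = ∑ i : Fin n, ∑ _b : Bool, ∑ j : Fin n, ∑ _b' : Bool,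
          (if i ≠ j then (1 - s)⁻¹ / 4 * p i * p j else 0) := by
        rw [Fintype.sum_prod_type, Fintype.sum_prod_type]
        refine sum_congr rfl fun i _ => sum_congr rfl fun b _ => ?_
        rw [Fintype.sum_prod_type]
        rfl
    _ = ∑ i : Fin n, 4 * ((1 - s)⁻¹ / 4 * p i * 1 - (1 - s)⁻¹ / 4 * p i ^ 2) := by
        refine sum_congr rfl fun i _ => ?_
        rw [← key i]
        simp only [Fintype.sum_bool, mul_sum, ← sum_add_distrib]
        refine sum_congr rfl fun j _ => ?_
        ring
    _ = (1 - s)⁻¹ * (∑ i : Fin n, p i - ∑ i : Fin n, p i ^ 2) := by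
        rw [← sum_sub_distrib, mul_sum]
        refine sum_congr rfl fun j _ => ?_
        ring
    _ = 1 := by rw [e1, e2]; field_simp

lemma Bs_mass_eq {a b : Lit n} (h : a.1 ≠ b.1) :
    ∑ c ∈ Bs a b, clauseProb2 n p c = Cconst n p / 2 * p a.1 * p b.1 := by
  have hne : (ng a, b) ≠ (b, ng a) := by
    intro h'
    simp only [Prod.mk.injEq] at h'
    apply h
    rw [← h'.1]; rfl
  rw [Bs, sum_pair hne]
  have e1 : clauseProb2 n p (ng a, b) = (1 - ∑ i ∈ range n, p i ^ 2)⁻¹ / 4 * p a.1 * p b.1 :=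
    if_pos h
  have e2 : clauseProb2 n p (b, ng a) = (1 - ∑ i ∈ range n, p i ^ 2)⁻¹ / 4 * p b.1 * p a.1 :=
    if_pos (Ne.symm h)
  rw [e1, e2, Cconst]
  ring

lemma Bs_mass_le (hp : ∀ i, i < n → 0 ≤ p i) (hs : ∑ i ∈ range n, p i ^ 2 < 1) (a b : Lit n) :
    ∑ c ∈ Bs a b, clauseProb2 n p c ≤ Cconst n p / 2 * p a.1 * p b.1 := by
  by_cases h : a.1 = b.1
  · have h1 := hp _ a.1.2
    have h2 := hp _ b.1.2
    have h3 : 0 ≤ Cconst n p := inv_nonneg.mpr (by linarith)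
    have : ∑ c ∈ Bs a b, clauseProb2 n p c = 0 := by
      refine sum_eq_zero fun c hc => ?_
      simp only [Bs, mem_insert, mem_singleton] at hc
      rcases hc with rfl | rfl <;> simp [clauseProb2, h]
    rw [this]
    positivity
  · exact (Bs_mass_eq h).le

end clause

/-- Implication edges of a formula. -/
def Edge {n m : ℕ} (Φ : Fin m → Lit n × Lit n) (a b : Lit n) : Prop := ∃ j, Φ j ∈ Bs a b

section extraction
variable {n m : ℕ} {Φ : Fin m → Lit n × Lit n}

lemma edge_symm {a b : Lit n} (h : Edge Φ a b) : Edge Φ (ng b) (ng a) := by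
  obtain ⟨j, hj⟩ := h
  exact ⟨j, by rw [Bs_symm]; exact hj⟩

lemma edge_symm' {a b : Lit n} (h : Edge Φ (ng a) b) : Edge Φ (ng b) a := by
  have := edge_symm h; simpa using this

lemma reach_symm {a b : Lit n} (h : Relation.ReflTransGen (Edge Φ) a b) :
    Relation.ReflTransGen (Edge Φ) (ng b) (ng a) := by
  induction h with
  | refl => exact Relation.ReflTransGen.refl
  | tail _ h ih => exact Relation.ReflTransGen.head (edge_symm h) ih

lemma sat_of_no_contra
    (h : ∀ x : Lit n, ¬ (Relation.ReflTransGen (Edge Φ) x (ng x) ∧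
      Relation.ReflTransGen (Edge Φ) (ng x) x)) : Sat2 Φ := by
  set Rr := Relation.ReflTransGen (Edge Φ)
  let F : Finset (Finset (Lit n)) := univ.filter fun S =>
    (∀ a ∈ S, ∀ b, Edge Φ a b → b ∈ S) ∧ ∀ a ∈ S, ng a ∉ S
  have hF : F.Nonempty := ⟨∅, by simp [F]⟩
  obtain ⟨S, hS, hmax⟩ := Finset.exists_max_image F Finset.card hF
  simp only [F, mem_filter, mem_univ, true_and] at hS
  obtain ⟨hcl, hcons⟩ := hS
  have hclR : ∀ a b, Rr a b → a ∈ S → b ∈ S := by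
    intro a b hab ha
    induction hab with
    | refl => exact ha
    | tail _ h1 ih => exact hcl _ ih _ h1
  have key : ∀ y : Lit n, y ∉ S → ng y ∉ S → ¬ Rr y (ng y) → False := by
    intro y h1 h2 h3
    let S' := S ∪ univ.filter fun z => Rr y z
    have hS' : S' ∈ F := by
      simp only [F, mem_filter, mem_univ, true_and, S', mem_union]
      constructor
      · rintro a (ha | ha) b hab
        · left; exact hcl _ ha _ hab
        · right; exact ha.tail hab
      · rintro a (ha | ha) (hb | hb)
        · exact hcons a ha hb
        · have := reach_symm hb
          rw [ng_ng] at this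
          exact h2 (hclR _ _ this ha)
        · exact h2 (hclR _ _ (reach_symm ha) hb)
        · exact h3 (hb.trans (reach_symm ha))
    have hlt : S.card < S'.card := by
      apply card_lt_card
      refine ⟨subset_union_left, fun hh => h1 (hh ?_)⟩
      simp only [S', mem_union, mem_filter, mem_univ, true_and]
      right; exact Relation.ReflTransGen.refl
    exact absurd (hmax S' hS') (by omega)
  have htot : ∀ y : Lit n, y ∉ S → ng y ∈ S := by
    intro y h1
    by_contra h2
    by_cases h3 : Rr y (ng y)
    · exact key (ng y) h2 (by simpa using h1) (by
        rw [ng_ng]; intro h4; exact h y ⟨h3, h4⟩)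
    · exact key y h1 h2 h3
  refine ⟨fun x => decide ((x, true) ∈ S), ?_⟩
  have hval : ∀ l : Lit n, l ∈ S → decide ((l.1, true) ∈ S) = l.2 := by
    rintro ⟨x, b⟩ hl
    cases b
    · have := hcons _ hl
      simpa [ng] using this
    · simpa using hl
  intro j
  by_cases h1 : (Φ j).1 ∈ S
  · left; exact hval _ h1
  · right
    apply hval
    refine hcl _ (htot _ h1) _ ⟨j, ?_⟩
    simp [Bs]

lemma exists_nat_bicycle (hU : ¬ Sat2 Φ) :
    ∃ (k : ℕ) (w : ℕ → Lit n) (t l : ℕ) (v : Lit n),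
      (∀ i, i < k → Edge Φ (w i) (w (i+1))) ∧
      (∀ i j, i ≤ k → j ≤ k → (w i).1 = (w j).1 → i = j) ∧
      t ≤ k ∧ Edge Φ (ng (w t)) (w 0) ∧ Edge Φ (w k) v ∧ l ≤ k ∧ v.1 = (w l).1 := by
  have h0 : ∃ x : Lit n, Relation.ReflTransGen (Edge Φ) x (ng x) ∧
      Relation.ReflTransGen (Edge Φ) (ng x) x := by
    by_contra hh
    push Not at hh
    exact hU (sat_of_no_contra fun x hx => hh x hx.1 hx.2)
  obtain ⟨x, hx1, hx2⟩ := h0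
  -- walks
  have walk : ∀ a b : Lit n, Relation.ReflTransGen (Edge Φ) a b →
      ∃ (t : ℕ) (w : ℕ → Lit n), w 0 = a ∧ w t = b ∧ ∀ i, i < t → Edge Φ (w i) (w (i+1)) := by
    intro a b hab
    induction hab with
    | refl => exact ⟨0, fun _ => a, rfl, rfl, by simp⟩
    | @tail b c _ hbc ih =>
      obtain ⟨t, w, h1, h2, h3⟩ := ih
      refine ⟨t+1, fun i => if i ≤ t then w i else c, by simp [h1], by simp, ?_⟩
      intro i hi
      rcases Nat.lt_succ_iff_lt_or_eq.mp hi with h | h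
      · simp only [show i ≤ t by omega, if_true, show i + 1 ≤ t by omega]
        exact h3 i h
      · subst h; simpa [h2] using hbc
  have walkR : ∀ (t : ℕ) (w : ℕ → Lit n), (∀ i, i < t → Edge Φ (w i) (w (i+1))) →
      ∀ i j, i ≤ j → j ≤ t → Relation.ReflTransGen (Edge Φ) (w i) (w j) := by
    intro t w hw i j hij
    induction j, hij using Nat.le_induction with
    | base => intro _; exact Relation.ReflTransGen.refl
    | succ j _ ih => intro hj; exact (ih (by omega)).tail (hw j (by omega))
  let Q : ℕ → Prop := fun t => ∃ w : ℕ → Lit n, w t = ng (w 0) ∧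
    (∀ i, i < t → Edge Φ (w i) (w (i+1))) ∧ Relation.ReflTransGen (Edge Φ) (w t) x
  have hQ : ∃ t, Q t := by
    obtain ⟨t, w, h1, h2, h3⟩ := walk _ _ hx1
    exact ⟨t, w, by rw [h1, h2], h3, by rw [h2]; exact hx2⟩
  obtain ⟨w, hwt, hwe, hwx⟩ := Nat.find_spec hQ
  set T := Nat.find hQ with hT
  have hmin : ∀ t, t < T → ¬ Q t := fun t ht => Nat.find_min hQ ht
  have hTpos : 0 < T := by
    rcases Nat.eq_zero_or_pos T with h | h
    · rw [h] at hwt; exact absurd hwt.symm (ng_ne _)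
    · exact h
  have hdist : ∀ i j, 1 ≤ i → i < j → j ≤ T → (w i).1 ≠ (w j).1 := by
    intro i j hi hij hj heq
    rcases eq_or_ng heq with h | h
    · apply hmin (T - (j - i)) (by omega)
      refine ⟨fun k => if k ≤ i then w k else w (k + (j - i)), ?_, ?_, ?_⟩
      · simp only [Nat.zero_le, if_true]
        split_ifs with h1
        · have : T - (j-i) = i := by omega
          rw [this, h, ← hwt]; congr 1; omega
        · rw [← hwt]; congr 1; omega
      · intro k hk
        by_cases h1 : k + 1 ≤ i
        · simp only [h1, if_true, show k ≤ i by omega]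
          exact hwe k (by omega)
        · by_cases h2 : k ≤ i
          · have : k = i := by omega
            subst this
            simp only [le_refl, if_true, h1, if_false]
            rw [h]
            have := hwe j (by omega)
            rwa [show j + 1 = k + 1 + (j - k) by omega] at this
          · simp only [h1, h2, if_false]
            have := hwe (k + (j - i)) (by omega)
            rwa [show k + (j - i) + 1 = k + 1 + (j - i) by omega] at this
      · simp only
        split_ifs with h1
        · have : T - (j-i) = i := by omega
          rw [this, h]
          have : j = T := by omega
          rw [this]; exact hwx
        · rwa [show T - (j - i) + (j - i) = T by omega]
    · apply hmin (j - i) (by omega)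
      refine ⟨fun k => w (i + k), ?_, ?_, ?_⟩
      · simp only [add_zero]
        rw [show i + (j - i) = j by omega, h, ng_ng]
      · intro k hk
        exact hwe (i + k) (by omega)
      · simp only
        rw [show i + (j - i) = j by omega]
        exact (walkR T w hwe j T hj le_rfl).trans hwx
  -- extend maximally
  let G : ℕ → Prop := fun k => ∃ (w : ℕ → Lit n) (t : ℕ),
      (∀ i, i < k → Edge Φ (w i) (w (i+1))) ∧
      (∀ i j, i ≤ k → j ≤ k → (w i).1 = (w j).1 → i = j) ∧
      t ≤ k ∧ Edge Φ (ng (w t)) (w 0) ∧ Relation.ReflTransGen (Edge Φ) (w k) x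
  have hG0 : G (T - 1) := by
    refine ⟨fun i => w (i+1), T - 1, fun i hi => hwe (i+1) (by omega), ?_, le_rfl, ?_, ?_⟩
    · intro i j hi hj hij
      by_contra hne
      rcases Nat.lt_or_gt_of_ne hne with h | h
      · exact hdist (i+1) (j+1) (by omega) (by omega) (by omega) hij
      · exact hdist (j+1) (i+1) (by omega) (by omega) (by omega) hij.symm
    · simp only
      rw [show T - 1 + 1 = T by omega, hwt, ng_ng]
      exact hwe 0 hTpos
    · simp only
      rw [show T - 1 + 1 = T by omega]; exact hwx
  have hGb : ∀ k, G k → k ≤ n := by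
    rintro k ⟨w, t, _, hd, _⟩
    have : Function.Injective (fun i : Fin (k+1) => (w i).1) := by
      intro i j hij
      exact Fin.ext (hd i j (by omega) (by omega) hij)
    have := Fintype.card_le_of_injective _ this
    simp at this
    omega
  obtain ⟨k, hk, hkmax⟩ : ∃ k, G k ∧ ¬ G (k+1) := by
    by_contra hh
    push Not at hh
    have : ∀ d, G (T - 1 + d) := by
      intro d
      induction d with
      | zero => exact hG0
      | succ d ih => exact hh _ ih
    have := hGb _ (this (n+1))
    omega
  obtain ⟨w, t, h1, h2, h3, h4, h5⟩ := hk
  have hv : ∃ v, Edge Φ (w k) v ∧ Relation.ReflTransGen (Edge Φ) v x := by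
    rcases Relation.ReflTransGen.cases_head h5 with h | ⟨c, hc, hcx⟩
    · rcases Relation.ReflTransGen.cases_head hx1 with h' | ⟨c, hc, hcx⟩
      · exact absurd h'.symm (ng_ne x)
      · exact ⟨c, by rw [h]; exact hc, hcx.trans hx2⟩
    · exact ⟨c, hc, hcx⟩
  obtain ⟨v, hv, hvx⟩ := hv
  have : ∃ l, l ≤ k ∧ v.1 = (w l).1 := by
    by_contra hh
    push Not at hh
    apply hkmax
    refine ⟨fun i => if i ≤ k then w i else v, t, ?_, ?_, by omega, ?_, ?_⟩
    · intro i hi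
      by_cases hi' : i < k
      · simp only [show i ≤ k by omega, show i + 1 ≤ k by omega, if_true]
        exact h1 i hi'
      · have : i = k := by omega
        subst this
        simpa using hv
    · intro i j hi hj hij
      by_cases hi' : i ≤ k <;> by_cases hj' : j ≤ k
      · simp only [hi', hj', if_true] at hij
        exact h2 i j hi' hj' hij
      · simp only [hi', hj', if_true, if_false] at hij
        exact absurd hij.symm (hh i hi')
      · simp only [hi', hj', if_true, if_false] at hij
        exact absurd hij (hh j hj')
      · omega
    · simpa [h3] using h4
    · simpa using hvx
  obtain ⟨l, hl, hvl⟩ := this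
  exact ⟨k, w, t, l, v, h1, h2, h3, h4, hv, hl, hvl⟩

lemma exists_bicycle (hU : ¬ Sat2 Φ) :
    ∃ s, s < n + 1 ∧ ∃ τ : (Fin s → Lit n) × Fin s × (Fin s × Bool), ∃ f : Fin (s+1) → Fin m,
      Function.Injective f ∧ ∀ e, Φ (f e) ∈
        Bs ((Fin.cons (ng (τ.1 τ.2.1)) τ.1 : Fin (s+1) → Lit n) e)
          ((Fin.snoc τ.1 ((τ.1 τ.2.2.1).1, τ.2.2.2) : Fin (s+1) → Lit n) e) := by
  obtain ⟨k, w, t, l, v, h1, h2, h3, h4, h5, h6, h7⟩ := exists_nat_bicycle hU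
  have hkn : k + 1 < n + 1 := by
    have : Function.Injective (fun i : Fin (k+1) => (w i).1) := by
      intro i j hij
      exact Fin.ext (h2 i j (by omega) (by omega) hij)
    have := Fintype.card_le_of_injective _ this
    simp at this
    omega
  refine ⟨k+1, hkn, ⟨fun i => w i, ⟨t, by omega⟩, ⟨l, by omega⟩, v.2⟩, ?_⟩
  simp only
  have hveq : ((w l).1, v.2) = v := by rw [← h7]
  rw [hveq]
  let A : ℕ → Lit n := fun e => if e = 0 then ng (w t) else w (e - 1)
  let D : ℕ → Lit n := fun e => if e < k + 1 then w e else v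
  have hA : ∀ e : Fin (k+1+1), (Fin.cons (ng (w t)) (fun i : Fin (k+1) => w i) :
      Fin (k+1+1) → Lit n) e = A e := by
    intro e
    refine Fin.cases ?_ (fun i => ?_) e
    · simp [A]
    · simp [A]
  have hD : ∀ e : Fin (k+1+1), (Fin.snoc (fun i : Fin (k+1) => w i) v :
      Fin (k+1+1) → Lit n) e = D e := by
    intro e
    refine Fin.lastCases ?_ (fun i => ?_) e
    · simp [D]
    · rw [Fin.snoc_castSucc]
      simp only [D, Fin.val_castSucc, i.isLt, if_true]
  have hE : ∀ e : Fin (k+1+1), Edge Φ (A e) (D e) := by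
    intro e
    by_cases he : (e:ℕ) = 0
    · simpa [A, D, he] using h4
    · by_cases he' : (e:ℕ) < k + 1
      · have := h1 (e - 1) (by omega)
        rw [show (e:ℕ) - 1 + 1 = e by omega] at this
        simp only [A, D, he, he', if_true, if_false]
        exact this
      · have : (e:ℕ) - 1 = k := by omega
        simp only [A, D, he, he', if_false, this]
        exact h5
  choose f hf using hE
  refine ⟨f, ?_, fun e => by rw [hA, hD]; exact hf e⟩
  have main : ∀ e e' : Fin (k+1+1), e < e' → f e ≠ f e' := by
    intro e e' hlt heq
    have m1 := hf e
    have m2 := hf e'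
    rw [← heq] at m2
    have hlt' : (e:ℕ) < e' := hlt
    have he' : (e':ℕ) ≠ 0 := by omega
    have hek : (e:ℕ) < k + 1 := by omega
    rcases Bs_both m1 m2 with ⟨g1, g2⟩ | ⟨g1, g2⟩
    · by_cases he : (e:ℕ) = 0
      · by_cases hl : (e':ℕ) < k + 1
        · simp only [D, hl, hek, if_true] at g2
          have := h2 _ _ (by omega) (by omega) (congrArg Prod.fst g2)
          omega
        · simp only [A, he, he', if_true, if_false] at g1
          have g3 : (w t).1 = (w ((e':ℕ) - 1)).1 := by
            have := congrArg Prod.fst g1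
            simpa using this
          have := h2 t _ h3 (by omega) g3
          rw [← this] at g1
          exact ng_ne _ g1
      · simp only [A, he, he', if_false] at g1
        have := h2 _ _ (by omega) (by omega) (congrArg Prod.fst g1)
        omega
    · simp only [A, D, hek, he', if_true, if_false] at g2
      have g3 : (w (e:ℕ)).1 = (w ((e':ℕ) - 1)).1 := by
        have := congrArg Prod.fst g2
        simpa using this
      have := h2 _ _ (by omega) (by omega) g3
      rw [← this] at g2
      exact ng_ne _ g2.symm
  intro e e' heq
  by_contra hne
  rcases lt_or_gt_of_ne hne with h | h
  · exact main e e' h heq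
  · exact main e' e h heq.symm

end extraction

section sat
variable {n m : ℕ} {p : ℕ → ℝ}

lemma total_mass (h1 : ∑ i ∈ range n, p i = 1) (hs : ∑ i ∈ range n, p i ^ 2 < 1) :
    ∑ Φ : Fin m → Lit n × Lit n, formulaProb2 n m p Φ = 1 := by
  have := Fintype.sum_pow (fun c : Lit n × Lit n => clauseProb2 n p c) m
  rw [clauseProb_sum h1 hs, one_pow] at this
  exact this.symm

lemma sat_add_unsat (h1 : ∑ i ∈ range n, p i = 1) (hs : ∑ i ∈ range n, p i ^ 2 < 1) :
    probSat2 n m p + probUnsat2 n m p = 1 := by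
  rw [← total_mass (m := m) h1 hs, probSat2, probUnsat2, ← sum_add_distrib]
  refine sum_congr rfl fun Φ _ => ?_
  by_cases h : Sat2 Φ <;> simp [h]

lemma prod_cons_snoc {α : Type*} (P : α → ℝ) (k : ℕ) (a b : α) (u : Fin k → α) :
    ∏ e : Fin (k+1), (P ((Fin.cons a u : Fin (k+1) → α) e) * P ((Fin.snoc u b : Fin (k+1) → α) e))
      = P a * P b * ∏ i, P (u i) ^ 2 := by
  rw [prod_mul_distrib, Fin.prod_univ_succ, Fin.prod_univ_castSucc (f := fun e => P ((Fin.snoc u b : Fin (k+1) → α) e))]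
  simp only [Fin.cons_zero, Fin.cons_succ, Fin.snoc_castSucc, Fin.snoc_last]
  rw [prod_pow]
  ring

lemma sum_lit_sq : ∑ a : Lit n, p a.1 ^ 2 = 2 * ∑ i ∈ range n, p i ^ 2 := by
  rw [Fintype.sum_prod_type, Finset.sum_range, mul_sum]
  refine sum_congr rfl fun i _ => ?_
  simp

lemma first_term (hp : ∀ i, i < n → 0 ≤ p i) (hs : ∑ i ∈ range n, p i ^ 2 < 1)
    (hmax : ∀ i, i < n → p i ≤ p 0) (s : ℕ) :
    ∑ τ : (Fin s → Lit n) × Fin s × (Fin s × Bool), (m:ℝ) ^ (Fintype.card (Fin (s+1))) *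
      ∏ e : Fin (s+1), ∑ c ∈ Bs ((Fin.cons (ng (τ.1 τ.2.1)) τ.1 : Fin (s+1) → Lit n) e)
        ((Fin.snoc τ.1 ((τ.1 τ.2.2.1).1, τ.2.2.2) : Fin (s+1) → Lit n) e), clauseProb2 n p c
    ≤ m * Cconst n p * p 0 ^ 2 * (s ^ 2 * (m * Cconst n p * ∑ i ∈ range n, p i ^ 2) ^ s) := by
  set C := Cconst n p with hC
  have hC0 : 0 ≤ C := inv_nonneg.mpr (by linarith)
  have hL : ∀ a : Lit n, 0 ≤ p a.1 := fun a => hp _ a.1.2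
  have hstep : ∀ τ : (Fin s → Lit n) × Fin s × (Fin s × Bool),
      (m:ℝ) ^ (Fintype.card (Fin (s+1))) *
      ∏ e : Fin (s+1), ∑ c ∈ Bs ((Fin.cons (ng (τ.1 τ.2.1)) τ.1 : Fin (s+1) → Lit n) e)
        ((Fin.snoc τ.1 ((τ.1 τ.2.2.1).1, τ.2.2.2) : Fin (s+1) → Lit n) e), clauseProb2 n p c
      ≤ (m * (C/2))^(s+1) * p 0 ^ 2 * ∏ i, p (τ.1 i).1 ^ 2 := by
    intro τ
    rw [Fintype.card_fin, mul_pow]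
    rw [mul_assoc, mul_assoc]
    refine mul_le_mul_of_nonneg_left ?_ (by positivity)
    calc _ ≤ ∏ e : Fin (s+1), (C/2 * (p ((Fin.cons (ng (τ.1 τ.2.1)) τ.1 : Fin (s+1) → Lit n) e).1 *
          p ((Fin.snoc τ.1 ((τ.1 τ.2.2.1).1, τ.2.2.2) : Fin (s+1) → Lit n) e).1)) := by
          refine prod_le_prod (fun e _ => sum_nonneg fun c _ => clauseProb_nonneg hp hs c) fun e _ => ?_
          rw [← mul_assoc]
          exact Bs_mass_le hp hs _ _
      _ = (C/2)^(s+1) * (p (ng (τ.1 τ.2.1)).1 * p (((τ.1 τ.2.2.1).1, τ.2.2.2) : Lit n).1 * ∏ i, p (τ.1 i).1 ^ 2) := by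
          rw [prod_mul_distrib, prod_const, card_univ, Fintype.card_fin]
          rw [prod_cons_snoc (fun a : Lit n => p a.1)]
      _ ≤ _ := by
          refine mul_le_mul_of_nonneg_left ?_ (by positivity)
          refine mul_le_mul_of_nonneg_right ?_ (prod_nonneg fun i _ => by positivity)
          rw [sq]
          exact mul_le_mul (hmax _ (Fin.isLt _)) (hmax _ (Fin.isLt _)) (hp _ (Fin.isLt _)) ((hp _ (Fin.isLt _)).trans (hmax _ (Fin.isLt (τ.1 τ.2.1).1)))
  refine (sum_le_sum fun τ _ => hstep τ).trans (le_of_eq ?_)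
  rw [← mul_sum, Fintype.sum_prod_type]
  have := Fintype.sum_pow (fun a : Lit n => p a.1 ^ 2) s
  simp only [sum_const, card_univ, nsmul_eq_mul, Fintype.card_prod, Fintype.card_fin, Fintype.card_bool]
  rw [← mul_sum, ← this, sum_lit_sq]
  push_cast
  rw [pow_succ, mul_pow, mul_pow, mul_pow, mul_pow, div_pow]
  field_simp

lemma unsat_le (hp : ∀ i, i < n → 0 ≤ p i) (h1 : ∑ i ∈ range n, p i = 1) (hs : ∑ i ∈ range n, p i ^ 2 < 1)
    (hmax : ∀ i, i < n → p i ≤ p 0) :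
    probUnsat2 n m p ≤ m * Cconst n p * p 0 ^ 2 *
      ∑ s ∈ range (n+1), ((s:ℝ) ^ 2 * (m * Cconst n p * ∑ i ∈ range n, p i ^ 2) ^ s) := by
  have h0 := clauseProb_nonneg hp hs
  have hs1 := clauseProb_sum h1 hs
  rw [mul_sum]
  refine le_trans ?_ (sum_le_sum fun s _ => (first_term (m := m) hp hs hmax s))
  have hfm := fun s : ℕ => first_moment (m := m) (clauseProb2 n p) h0 hs1
    (fun (τ : (Fin s → Lit n) × Fin s × (Fin s × Bool)) (e : Fin (s+1)) =>
      Bs ((Fin.cons (ng (τ.1 τ.2.1)) τ.1 : Fin (s+1) → Lit n) e)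
        ((Fin.snoc τ.1 ((τ.1 τ.2.2.1).1, τ.2.2.2) : Fin (s+1) → Lit n) e))
  refine le_trans ?_ (sum_le_sum fun s _ => hfm s)
  rw [probUnsat2, sum_comm]
  refine sum_le_sum fun Φ _ => ?_
  have hnn : 0 ≤ ∏ j, clauseProb2 n p (Φ j) := prod_nonneg fun j _ => h0 _
  by_cases hU : ¬ Sat2 Φ
  · rw [if_pos hU]
    obtain ⟨s, hs', hτ⟩ := exists_bicycle hU
    refine le_trans ?_ (single_le_sum (fun s _ => ?_) (mem_range.mpr hs'))
    · rw [if_pos hτ]; exact le_rfl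
    · split_ifs
      · exact hnn
      · exact le_rfl
  · rw [if_neg hU]
    refine sum_nonneg fun s _ => ?_
    split_ifs
    · exact hnn
    · exact le_rfl

lemma probSat_nonneg (hp : ∀ i, i < n → 0 ≤ p i) (hs : ∑ i ∈ range n, p i ^ 2 < 1) :
    0 ≤ probSat2 n m p := by
  refine sum_nonneg fun Φ _ => ?_
  split_ifs
  · exact prod_nonneg fun j _ => clauseProb_nonneg hp hs _
  · exact le_rfl

lemma probUnsat_nonneg (hp : ∀ i, i < n → 0 ≤ p i) (hs : ∑ i ∈ range n, p i ^ 2 < 1) :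
    0 ≤ probUnsat2 n m p := by
  refine sum_nonneg fun Φ _ => ?_
  split_ifs
  · exact le_rfl
  · exact prod_nonneg fun j _ => clauseProb_nonneg hp hs _

lemma probSat_succ_le (hp : ∀ i, i < n → 0 ≤ p i) (h1 : ∑ i ∈ range n, p i = 1)
    (hs : ∑ i ∈ range n, p i ^ 2 < 1) : probSat2 n (m+1) p ≤ probSat2 n m p := by
  unfold probSat2
  rw [← (Fin.consEquiv (fun _ : Fin (m+1) => Lit n × Lit n)).sum_comp, Fintype.sum_prod_type, sum_comm]
  refine sum_le_sum fun Φ _ => ?_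
  have hnn : 0 ≤ formulaProb2 n m p Φ := prod_nonneg fun j _ => clauseProb_nonneg hp hs _
  have hle : ∀ c : Lit n × Lit n, (if Sat2 ((Fin.consEquiv (fun _ : Fin (m+1) => Lit n × Lit n)) (c, Φ)) then
      formulaProb2 n (m+1) p ((Fin.consEquiv (fun _ : Fin (m+1) => Lit n × Lit n)) (c, Φ)) else 0)
      ≤ clauseProb2 n p c * (if Sat2 Φ then formulaProb2 n m p Φ else 0) := by
    intro c
    have e : formulaProb2 n (m+1) p ((Fin.consEquiv (fun _ : Fin (m+1) => Lit n × Lit n)) (c, Φ))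
        = clauseProb2 n p c * formulaProb2 n m p Φ := by
      simp [formulaProb2, Fin.prod_univ_succ, Fin.consEquiv]
    by_cases h : Sat2 ((Fin.consEquiv (fun _ : Fin (m+1) => Lit n × Lit n)) (c, Φ))
    · have h' : Sat2 Φ := by
        obtain ⟨a, ha⟩ := h
        refine ⟨a, fun j => ?_⟩
        have := ha j.succ
        simpa [Fin.consEquiv] using this
      rw [if_pos h, if_pos h', e]
    · rw [if_neg h]
      refine mul_nonneg (clauseProb_nonneg hp hs c) ?_
      split_ifs
      · exact hnn
      · exact le_rfl
  refine (sum_le_sum fun c _ => hle c).trans ?_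
  rw [← sum_mul, clauseProb_sum h1 hs, one_mul]

lemma probSat_anti (hp : ∀ i, i < n → 0 ≤ p i) (h1 : ∑ i ∈ range n, p i = 1)
    (hs : ∑ i ∈ range n, p i ^ 2 < 1) {m m' : ℕ} (h : m ≤ m') : probSat2 n m' p ≤ probSat2 n m p :=
  antitone_nat_of_succ_le (f := fun m => probSat2 n m p) (fun _ => probSat_succ_le hp h1 hs) h

end sat

section paths
variable {α : Type*}

lemma path_sum [Fintype α] [DecidableEq α] (A : Matrix α α ℝ) (k : ℕ) (a b : α) :
    ∑ u : Fin k → α, ∏ e : Fin (k+1), A ((Fin.cons a u : Fin (k+1) → α) e)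
      ((Fin.snoc u b : Fin (k+1) → α) e) = (A ^ (k+1)) a b := by
  induction k generalizing a with
  | zero =>
    simp [Fin.snoc]
  | succ k ih =>
    rw [← (Fin.consEquiv (fun _ : Fin (k+1) => α)).sum_comp, Fintype.sum_prod_type, pow_succ',
      Matrix.mul_apply]
    refine sum_congr rfl fun x _ => ?_
    rw [← ih x, mul_sum]
    refine sum_congr rfl fun u _ => ?_
    rw [Fin.prod_univ_succ]
    have e1 : (Fin.consEquiv (fun _ : Fin (k+1) => α)) (x, u) = Fin.cons x u := rfl
    rw [e1, ← Fin.cons_snoc_eq_snoc_cons]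
    simp only [Fin.cons_zero, Fin.cons_succ]

lemma path_rel (R : α → α → Prop) (k : ℕ) (a b : α) (u : Fin k → α)
    (h : ∀ e : Fin (k+1), R ((Fin.cons a u : Fin (k+1) → α) e) ((Fin.snoc u b : Fin (k+1) → α) e)) :
    Relation.ReflTransGen R a b := by
  induction k generalizing a with
  | zero =>
    have := h 0
    simp [Fin.snoc] at this
    exact Relation.ReflTransGen.single this
  | succ k ih =>
    obtain ⟨x, u, rfl⟩ : ∃ x u', u = Fin.cons x u' := ⟨u 0, Fin.tail u, (Fin.cons_self_tail u).symm⟩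
    rw [← Fin.cons_snoc_eq_snoc_cons] at h
    have h0 := h 0
    simp only [Fin.cons_zero] at h0
    refine Relation.ReflTransGen.head h0 (ih x u fun e => ?_)
    simpa only [Fin.cons_succ] using h e.succ

lemma cons_snoc_ne {β : Type*} (v : α → β) (k : ℕ) (hk : 1 ≤ k) (a b : α) (u : Fin k → α)
    (hu : ∀ i i', v (u i) = v (u i') → i = i') (ha : ∀ i, v (u i) ≠ v a) (hb : ∀ i, v (u i) ≠ v b)
    (e : Fin (k+1)) : v ((Fin.cons a u : Fin (k+1) → α) e) ≠ v ((Fin.snoc u b : Fin (k+1) → α) e) := by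
  refine Fin.cases ?_ (fun i => ?_) e
  · have : (0 : Fin (k+1)) = Fin.castSucc ⟨0, hk⟩ := rfl
    rw [Fin.cons_zero, this, Fin.snoc_castSucc]
    exact fun h => ha _ h.symm
  · rw [Fin.cons_succ]
    by_cases h : (i:ℕ) + 1 < k
    · have : i.succ = Fin.castSucc ⟨i+1, h⟩ := rfl
      rw [this, Fin.snoc_castSucc]
      intro h'
      have := congrArg Fin.val (hu _ _ h')
      simp at this
    · have : i.succ = Fin.last k := by
        ext; simp; omega
      rw [this, Fin.snoc_last]
      exact hb _

/-- Lower bound for the weight of injective tuples. -/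
lemma inj_weight {β : Type*} [Fintype α] (v : α → β) (w : α → ℝ) (hw : ∀ a, 0 ≤ w a)
    (Q : ℝ) (hQ0 : 0 ≤ Q) (hQ : ∀ y, ∑ a, (if v a = y then w a else 0) ≤ Q) (N : ℕ) (F : Finset β)
    (hW : (F.card + N) * Q ≤ ∑ a, w a) :
    (∑ a, w a - (F.card + N) * Q) ^ N ≤
      ∑ u : Fin N → α, if Function.Injective (v ∘ u) ∧ ∀ i, v (u i) ∉ F then ∏ i, w (u i) else 0 := by
  induction N generalizing F with
  | zero => simp [Function.injective_of_subsingleton]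
  | succ N ih =>
    set W := ∑ a, w a with hWd
    rw [← (Fin.consEquiv (fun _ : Fin (N+1) => α)).sum_comp, Fintype.sum_prod_type]
    set B := W - (F.card + (N+1 : ℕ)) * Q with hB
    have hB0 : 0 ≤ B := by rw [hB]; linarith
    have step : ∀ a, (if v a ∈ F then 0 else w a) * B ^ N ≤
        ∑ u : Fin N → α, if Function.Injective (v ∘ (Fin.consEquiv (fun _ : Fin (N+1) => α)) (a, u)) ∧
          ∀ i, v ((Fin.consEquiv (fun _ : Fin (N+1) => α)) (a, u) i) ∉ F then
            ∏ i, w ((Fin.consEquiv (fun _ : Fin (N+1) => α)) (a, u) i) else 0 := by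
      intro a
      by_cases ha : v a ∈ F
      · rw [if_pos ha, zero_mul]
        refine sum_nonneg fun u _ => ?_
        split_ifs
        · exact prod_nonneg fun i _ => hw _
        · exact le_rfl
      · rw [if_neg ha]
        have hc : ((insert (v a) F).card : ℝ) = F.card + 1 := by
          rw [card_insert_of_notMem ha]; push_cast; ring
        have hi := ih (insert (v a) F) (by rw [hc]; push_cast at hW; linarith)
        rw [hc] at hi
        have e : W - ((F.card:ℝ) + 1 + N) * Q = B := by rw [hB]; push_cast; ring
        rw [e] at hi
        refine (mul_le_mul_of_nonneg_left hi (hw a)).trans ?_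
        rw [mul_sum]
        refine sum_le_sum fun u _ => ?_
        have e1 : (Fin.consEquiv (fun _ : Fin (N+1) => α)) (a, u) = Fin.cons a u := rfl
        rw [e1]
        by_cases h : Function.Injective (v ∘ u) ∧ ∀ i, v (u i) ∉ insert (v a) F
        · rw [if_pos h, if_pos]
          · rw [Fin.prod_univ_succ]; simp
          · refine ⟨?_, ?_⟩
            · have e2 : v ∘ (Fin.cons a u : Fin (N+1) → α) = Fin.cons (v a) (v ∘ u) := by
                ext i; refine Fin.cases ?_ (fun i => ?_) i <;> simp
              rw [e2, Fin.cons_injective_iff]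
              refine ⟨?_, h.1⟩
              rintro ⟨i, hi⟩
              exact h.2 i (by simp at hi; simp [hi])
            · intro i
              refine Fin.cases ?_ (fun i => ?_) i
              · simpa using ha
              · simp only [Fin.cons_succ]
                intro h'
                exact h.2 i (mem_insert_of_mem h')
        · rw [if_neg h, mul_zero]
          split_ifs
          · exact prod_nonneg fun i _ => hw _
          · exact le_rfl
    refine le_trans ?_ (sum_le_sum fun a _ => step a)
    rw [← sum_mul, pow_succ']
    refine mul_le_mul_of_nonneg_right ?_ (pow_nonneg hB0 N)
    have h1 : ∀ a, (if v a ∈ F then 0 else w a) = w a - ∑ y ∈ F, if v a = y then w a else 0 := by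
      intro a
      rw [Finset.sum_ite_eq]
      split_ifs <;> simp
    simp_rw [h1]
    rw [sum_sub_distrib, sum_comm]
    have h2 : ∑ y ∈ F, ∑ a, (if v a = y then w a else 0) ≤ F.card * Q := by
      rw [← nsmul_eq_mul]
      exact sum_le_card_nsmul _ _ _ fun y _ => hQ y
    rw [hB]; push_cast
    nlinarith [mul_nonneg (Nat.cast_nonneg (α := ℝ) N) hQ0]

lemma inj_weight' {β I : Type*} [Fintype α] [Fintype I] [DecidableEq I] (v : α → β) (w : α → ℝ) (hw : ∀ a, 0 ≤ w a)
    (Q : ℝ) (hQ0 : 0 ≤ Q) (hQ : ∀ y, ∑ a, (if v a = y then w a else 0) ≤ Q) (F : Finset β)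
    (hW : (F.card + (Fintype.card I : ℝ)) * Q ≤ ∑ a, w a) :
    (∑ a, w a - (F.card + (Fintype.card I : ℝ)) * Q) ^ (Fintype.card I) ≤
      ∑ u : I → α, if Function.Injective (v ∘ u) ∧ ∀ i, v (u i) ∉ F then ∏ i, w (u i) else 0 := by
  refine (inj_weight v w hw Q hQ0 hQ (Fintype.card I) F hW).trans (le_of_eq ?_)
  let e := Fintype.equivFin I
  rw [← (Equiv.arrowCongr e (Equiv.refl α)).sum_comp]
  refine sum_congr rfl fun u _ => ?_
  have h1 : Function.Injective (v ∘ (Equiv.arrowCongr e (Equiv.refl α)) u) ↔ Function.Injective (v ∘ u) := by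
    have : v ∘ (Equiv.arrowCongr e (Equiv.refl α)) u = (v ∘ u) ∘ e.symm := rfl
    rw [this]
    exact e.symm.injective_comp _
  have h2 : (∀ i, v ((Equiv.arrowCongr e (Equiv.refl α)) u i) ∉ F) ↔ ∀ i, v (u i) ∉ F := by
    have : ∀ i, (Equiv.arrowCongr e (Equiv.refl α)) u i = u (e.symm i) := fun _ => rfl
    simp only [this]
    exact e.symm.forall_congr_left.trans (by simp)
  have h3 : ∏ i, w ((Equiv.arrowCongr e (Equiv.refl α)) u i) = ∏ i, w (u i) :=
    e.symm.prod_comp (fun i => w (u i))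
  rw [h3]
  simp only [h1, h2]

end paths

section dom
variable {α : Type*} [Fintype α] [DecidableEq α]

lemma mul_row_le (E : Matrix α α ℝ) (hE : ∀ a b, 0 ≤ E a b) (h : α → ℝ) (ρ : ℝ) (hρ : 1 ≤ ρ)
    (hE1 : ∀ y, ∑ b, E y b ≤ h y) (hEh : ∀ y, ∑ b, E y b * h b ≤ ρ * h y) (k : ℕ) (y : α) :
    ∑ b, (E ^ (k+1)) y b ≤ ρ ^ k * h y := by
  induction k generalizing y with
  | zero => simpa using hE1 y
  | succ k ih =>
    rw [pow_succ' E]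
    simp_rw [Matrix.mul_apply]
    rw [sum_comm]
    simp_rw [← mul_sum]
    calc _ ≤ ∑ i, E y i * (ρ ^ k * h i) := sum_le_sum fun i _ => mul_le_mul_of_nonneg_left (ih i) (hE _ _)
      _ = ρ ^ k * ∑ i, E y i * h i := by rw [mul_sum]; exact sum_congr rfl fun _ _ => by ring
      _ ≤ ρ ^ k * (ρ * h y) := mul_le_mul_of_nonneg_left (hEh y) (by positivity)
      _ = _ := by ring

lemma pow_entry_nonneg (E : Matrix α α ℝ) (hE : ∀ a b, 0 ≤ E a b) (k : ℕ) (a b : α) : 0 ≤ (E ^ k) a b := by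
  induction k generalizing a b with
  | zero => simp [Matrix.one_apply]; split_ifs <;> norm_num
  | succ k ih =>
    rw [pow_succ, Matrix.mul_apply]
    exact sum_nonneg fun i _ => mul_nonneg (ih _ _) (hE _ _)

/-- Domination of the powers of a rank one matrix plus a sparse one. -/
lemma pow_dom (E : Matrix α α ℝ) (hE : ∀ a b, 0 ≤ E a b) (N : α → α) (hN : ∀ a, N (N a) = a)
    (hsym : ∀ a b, E (N b) (N a) = E a b) (p h : α → ℝ) (hp : ∀ a, 0 ≤ p a) (hh : ∀ a, 0 ≤ h a)
    (hpN : ∀ a, p (N a) = p a) (q κ c ρ b γ : ℝ) (hpq : ∀ a, p a ≤ q) (hκ : 0 < κ) (hc : 0 ≤ c)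
    (hq : 0 ≤ q) (hρ : 1 ≤ ρ)
    (hE1 : ∀ y, ∑ b, E y b ≤ h y) (hEh : ∀ y, ∑ b, E y b * h b ≤ ρ * h y)
    (hb1 : ρ + 1 / κ ≤ b) (hγ : κ * q ^ 2 * ∑ y, h y ≤ γ) (hb2 : c * (∑ y, p y ^ 2 + γ) ≤ b)
    (k : ℕ) (hk : ρ ^ k ≤ 3) (y x : α) :
    ((Matrix.of fun a b => c * p a * p b + E a b) ^ (k+1)) y x ≤
      (E ^ (k+1)) y x + c * (b ^ k * (1 + 3 * k / κ)) * (p y + κ * q * h y) * (p (N x) + κ * q * h (N x)) := by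
  set A : Matrix α α ℝ := Matrix.of fun a b => c * p a * p b + E a b with hA
  set g : α → ℝ := fun y => p y + κ * q * h y with hg
  have hA0 : ∀ a b, 0 ≤ A a b := fun a b => by
    simp only [hA, Matrix.of_apply]
    have := hp a; have := hp b; have := hE a b; positivity
  have hAs : ∀ a b, A (N b) (N a) = A a b := fun a b => by
    simp only [hA, Matrix.of_apply, hpN, hsym]; ring
  have hg0 : ∀ a, 0 ≤ g a := fun a => by
    have := hp a; have := hh a; simp only [hg]; positivity
  have hpg : ∀ a, p a ≤ g a := fun a => by
    have := hh a
    have : 0 ≤ κ * q * h a := by positivity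
    simp only [hg]; linarith
  have hb : 1 ≤ b := by
    have : 0 ≤ 1 / κ := by positivity
    linarith
  have hAg : ∀ y, ∑ x, A y x * g x ≤ b * g y := by
    intro y
    have e1 : ∑ x, A y x * g x = c * p y * (∑ x, p x ^ 2 + κ * q * ∑ x, p x * h x)
        + (∑ x, E y x * p x + κ * q * ∑ x, E y x * h x) := by
      simp only [hA, hg, Matrix.of_apply, mul_sum, ← sum_add_distrib]
      exact sum_congr rfl fun x _ => by ring
    have e2 : ∑ x, p x * h x ≤ q * ∑ x, h x := by
      rw [mul_sum]; exact sum_le_sum fun x _ => mul_le_mul_of_nonneg_right (hpq x) (hh x)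
    have e3 : ∑ x, E y x * p x ≤ q * h y := by
      calc _ ≤ ∑ x, E y x * q := sum_le_sum fun x _ => mul_le_mul_of_nonneg_left (hpq x) (hE _ _)
        _ = q * ∑ x, E y x := by rw [← sum_mul, mul_comm]
        _ ≤ _ := mul_le_mul_of_nonneg_left (hE1 y) hq
    have e4 : κ * q * ∑ x, p x * h x ≤ γ := by
      refine le_trans ?_ hγ
      have := mul_le_mul_of_nonneg_left e2 (show 0 ≤ κ * q by positivity)
      nlinarith
    have e5 : c * p y * (∑ x, p x ^ 2 + κ * q * ∑ x, p x * h x) ≤ b * p y := by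
      calc _ ≤ c * p y * (∑ x, p x ^ 2 + γ) := by
            refine mul_le_mul_of_nonneg_left ?_ (mul_nonneg hc (hp y)); linarith
        _ = c * (∑ x, p x ^ 2 + γ) * p y := by ring
        _ ≤ _ := mul_le_mul_of_nonneg_right hb2 (hp y)
    have e6 : ∑ x, E y x * p x + κ * q * ∑ x, E y x * h x ≤ b * (κ * q * h y) := by
      have : κ * q * ∑ x, E y x * h x ≤ κ * q * (ρ * h y) :=
        mul_le_mul_of_nonneg_left (hEh y) (by positivity)
      have e7 : (ρ + 1/κ) * (κ * q * h y) ≤ b * (κ * q * h y) :=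
        mul_le_mul_of_nonneg_right hb1 (by have := hh y; positivity)
      have e8 : (ρ + 1/κ) * (κ * q * h y) = κ * q * (ρ * h y) + q * h y := by field_simp
      linarith
    rw [e1]
    simp only [hg]
    linarith
  have hgA : ∀ x, ∑ y, g (N y) * A y x ≤ b * g (N x) := by
    intro x
    refine le_trans (le_of_eq ?_) (hAg (N x))
    let eN : α ≃ α := ⟨N, N, hN, hN⟩
    rw [← eN.sum_comp]
    refine sum_congr rfl fun y _ => ?_
    show g (N (N y)) * A (N y) x = A (N x) y * g y
    rw [hN, ← hAs, hN, mul_comm]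
  have hmono : ∀ j, j ≤ k → ρ ^ j ≤ 3 := fun j hj => (pow_le_pow_right₀ hρ hj).trans hk
  clear hk
  have main : ∀ j : ℕ, (∀ i ≤ j, ρ ^ i ≤ 3) → ∀ y x, (A ^ (j+1)) y x ≤ (E ^ (j+1)) y x + c * (b ^ j * (1 + 3 * j / κ)) * g y * g (N x) := by
    intro j
    induction j with
    | zero =>
      intro _ y x
      simp only [zero_add, pow_one, pow_zero, Nat.cast_zero, mul_zero, zero_div, add_zero, mul_one]
      have : c * p y * p x ≤ c * g y * g (N x) := by
        rw [← hpN x]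
        refine mul_le_mul (mul_le_mul_of_nonneg_left (hpg _) hc) (hpg _) (hp _) (mul_nonneg hc (hg0 _))
      have e : A y x = c * p y * p x + E y x := rfl
      rw [e]; linarith
    | succ j ih =>
      intro hρj y x
      have ih := ih (fun i hi => hρj i (by omega))
      rw [pow_succ A (j+1), Matrix.mul_apply]
      set d := b ^ j * (1 + 3 * j / κ) with hd
      have hd0 : 0 ≤ d := by positivity
      have s1 : ∑ i, (A ^ (j+1)) y i * A i x ≤ ∑ i, ((E ^ (j+1)) y i * (c * p i * p x + E i x)
          + c * d * g y * (g (N i) * A i x)) := by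
        refine sum_le_sum fun i _ => ?_
        have := mul_le_mul_of_nonneg_right (ih y i) (hA0 i x)
        have e : A i x = c * p i * p x + E i x := rfl
        rw [← e]; linarith
      have s2 : ∑ i, ((E ^ (j+1)) y i * (c * p i * p x + E i x)
          + c * d * g y * (g (N i) * A i x)) = c * p x * (∑ i, (E ^ (j+1)) y i * p i) + (E ^ (j+1+1)) y x
          + c * d * g y * ∑ i, g (N i) * A i x := by
        rw [pow_succ E (j+1), Matrix.mul_apply]
        simp only [mul_sum, ← sum_add_distrib]
        exact sum_congr rfl fun x _ => by ring
      have s3 : ∑ i, (E ^ (j+1)) y i * p i ≤ 3 / κ * g y := by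
        calc _ ≤ ∑ i, (E ^ (j+1)) y i * q := sum_le_sum fun i _ =>
              mul_le_mul_of_nonneg_left (hpq i) (pow_entry_nonneg E hE _ _ _)
          _ = q * ∑ i, (E ^ (j+1)) y i := by rw [← sum_mul, mul_comm]
          _ ≤ q * (ρ ^ j * h y) := mul_le_mul_of_nonneg_left (mul_row_le E hE h ρ hρ hE1 hEh j y) hq
          _ ≤ q * (3 * h y) := by
              refine mul_le_mul_of_nonneg_left ?_ hq
              exact mul_le_mul_of_nonneg_right (hρj j (by omega)) (hh y)
          _ = 3 / κ * (κ * q * h y) := by field_simp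
          _ ≤ 3 / κ * g y := by
              refine mul_le_mul_of_nonneg_left ?_ (by positivity)
              have := hp y
              simp only [hg]; linarith
      have s4 : c * p x * (∑ i, (E ^ (j+1)) y i * p i) ≤ c * (3 / κ) * g y * g (N x) := by
        have h1 : p x ≤ g (N x) := by rw [← hpN x]; exact hpg _
        have h2 : 0 ≤ 3 / κ * g y := by have := hg0 y; positivity
        calc _ ≤ c * p x * (3 / κ * g y) := mul_le_mul_of_nonneg_left s3 (mul_nonneg hc (hp x))
          _ ≤ c * g (N x) * (3 / κ * g y) := by
            exact mul_le_mul_of_nonneg_right (mul_le_mul_of_nonneg_left h1 hc) h2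
          _ = _ := by ring
      have s5 : c * d * g y * ∑ i, g (N i) * A i x ≤ c * d * g y * (b * g (N x)) := by
        refine mul_le_mul_of_nonneg_left (hgA x) ?_
        have := hg0 y; positivity
      have s6 : 3 / κ + d * b ≤ b ^ (j+1) * (1 + 3 * ((j+1 : ℕ):ℝ) / κ) := by
        have h1 : (1:ℝ) ≤ b ^ (j+1) := one_le_pow₀ hb
        have h2 : b ^ (j+1) * (1 + 3 * ((j+1 : ℕ):ℝ) / κ) = d * b + b ^ (j+1) * (3/κ) := by
          rw [hd]; push_cast; ring
        have h3 : 0 ≤ 3 / κ := by positivity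
        rw [h2]; nlinarith
      have s7 : c * (3/κ + d * b) * g y * g (N x) ≤ c * (b ^ (j+1) * (1 + 3 * ((j+1 : ℕ):ℝ) / κ)) * g y * g (N x) := by
        have := hg0 y; have := hg0 (N x)
        gcongr
      calc _ ≤ _ := s1
        _ = _ := s2
        _ ≤ c * (3 / κ) * g y * g (N x) + (E ^ (j+1+1)) y x + c * d * g y * (b * g (N x)) := by linarith
        _ = (E ^ (j+1+1)) y x + c * (3/κ + d * b) * g y * g (N x) := by ring
        _ ≤ _ := by linarith
  exact main k hmono y x

end dom

section domsum
variable {α : Type*} [Fintype α] [DecidableEq α]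

lemma dom_sum (E : Matrix α α ℝ) (hE : ∀ a b, 0 ≤ E a b) (N : α → α) (hN : ∀ a, N (N a) = a)
    (hsym : ∀ a b, E (N b) (N a) = E a b) (p h : α → ℝ) (hp : ∀ a, 0 ≤ p a) (hh : ∀ a, 0 ≤ h a)
    (hpN : ∀ a, p (N a) = p a) (q κ c ρ b H : ℝ) (hpq : ∀ a, p a ≤ q) (hκ : 0 < κ) (hc : 0 ≤ c)
    (hq : 0 ≤ q) (hρ : 1 ≤ ρ)
    (hE1 : ∀ y, ∑ b, E y b ≤ h y) (hEh : ∀ y, ∑ b, E y b * h b ≤ ρ * h y)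
    (hb1 : ρ + 1 / κ ≤ b) (hH : ∑ y, h y ≤ H) (hb2 : c * (∑ y, p y ^ 2 + κ * q ^ 2 * H) ≤ b)
    (k : ℕ) (hk : ρ ^ k ≤ 3) (M d : ℝ) (hM : M = 1 + κ * H) (hd : d = b ^ k * (1 + 3 * k / κ)) :
    ∑ x, ((Matrix.of fun a b => c * p a * p b + E a b) ^ (k+1)) x (N x) *
      ((Matrix.of fun a b => c * p a * p b + E a b) ^ (k+1)) (N x) x ≤
      (c * d) ^ 2 * (∑ y, p y ^ 4 + 4 * κ * H * M ^ 3 * q ^ 4) + 6 * H * (c * d * (q * M) ^ 2) + 9 * H ^ 2 := by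
  set A : Matrix α α ℝ := Matrix.of fun a b => c * p a * p b + E a b with hA
  have hA0 : ∀ a b, 0 ≤ A a b := fun a b => by
    simp only [hA, Matrix.of_apply]
    have := hp a; have := hp b; have := hE a b; positivity
  set g : α → ℝ := fun y => p y + κ * q * h y with hg
  have hg0 : ∀ a, 0 ≤ g a := fun a => by
    have := hp a; have := hh a; simp only [hg]; positivity
  have hH0 : 0 ≤ H := (sum_nonneg fun y _ => hh y).trans hH
  have hhH : ∀ y, h y ≤ H := fun y => (single_le_sum (fun y _ => hh y) (mem_univ y)).trans hH
  have hM0 : 0 ≤ M := by rw [hM]; positivity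
  have hb0 : 0 ≤ b := by
    have : 0 ≤ 1 / κ := by positivity
    linarith
  have hd0 : 0 ≤ d := by rw [hd]; positivity
  have hgM : ∀ y, g y ≤ q * M := fun y => by
    have h1 := hpq y
    have h2 : κ * q * h y ≤ κ * q * H := mul_le_mul_of_nonneg_left (hhH y) (by positivity)
    simp only [hg]
    rw [hM]; linarith
  have key : ∀ y, (A ^ (k+1)) y (N y) ≤ 3 * h y + c * d * g y ^ 2 := by
    intro y
    have h1 := pow_dom E hE N hN hsym p h hp hh hpN q κ c ρ b (κ * q ^ 2 * H) hpq hκ hc hq hρ hE1 hEh hb1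
      (mul_le_mul_of_nonneg_left hH (by positivity)) hb2 k hk y (N y)
    rw [hN, ← hd] at h1
    have h2 : (E ^ (k+1)) y (N y) ≤ 3 * h y := by
      refine (single_le_sum (f := fun b => (E ^ (k+1)) y b) (fun b _ => pow_entry_nonneg E hE _ _ _) (mem_univ (N y))).trans ?_
      refine (mul_row_le E hE h ρ hρ hE1 hEh k y).trans ?_
      exact mul_le_mul_of_nonneg_right hk (hh y)
    refine h1.trans ?_
    simp only [hg]
    linarith [h2]
  set P : α → ℝ := fun y => 3 * h y + c * d * g y ^ 2 with hP
  have hP0 : ∀ y, 0 ≤ P y := fun y => by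
    have := hh y; have := hg0 y; simp only [hP]; positivity
  let eN : α ≃ α := ⟨N, N, hN, hN⟩
  have s1 : ∑ x, (A ^ (k+1)) x (N x) * (A ^ (k+1)) (N x) x ≤ ∑ x, P x ^ 2 := by
    have hle : ∀ x, (A ^ (k+1)) x (N x) * (A ^ (k+1)) (N x) x ≤ (P x ^ 2 + P (N x) ^ 2) / 2 := by
      intro x
      have h1 := key x
      have h2 := key (N x)
      rw [hN] at h2
      have := mul_le_mul h1 h2 (pow_entry_nonneg A hA0 _ _ _) (hP0 x)
      refine this.trans ?_
      show P x * P (N x) ≤ _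
      nlinarith [sq_nonneg (P x - P (N x))]
    refine (sum_le_sum fun x _ => hle x).trans (le_of_eq ?_)
    rw [← sum_div, sum_add_distrib]
    have : ∑ x, P (N x) ^ 2 = ∑ x, P x ^ 2 := eN.sum_comp (fun x => P x ^ 2)
    rw [this]; ring
  refine s1.trans ?_
  have s2 : ∀ x, P x ^ 2 ≤ 9 * H * h x + 6 * (c * d * (q * M) ^ 2) * h x
      + (c * d) ^ 2 * (p x ^ 4 + 4 * κ * M ^ 3 * q ^ 4 * h x) := by
    intro x
    have hx := hh x
    have hgx := hg0 x
    have t1 : h x ^ 2 ≤ H * h x := by rw [sq]; exact mul_le_mul_of_nonneg_right (hhH x) hx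
    have t2 : g x ^ 2 ≤ (q * M) ^ 2 := pow_le_pow_left₀ hgx (hgM x) 2
    have t3 : g x ^ 4 ≤ p x ^ 4 + 4 * κ * M ^ 3 * q ^ 4 * h x := by
      have u1 : g x ^ 4 - p x ^ 4 ≤ 4 * (κ * q * h x) * g x ^ 3 := by
        have e : g x = p x + κ * q * h x := rfl
        set t := κ * q * h x with ht
        have ht0 : 0 ≤ t := by positivity
        have := hp x
        rw [e]
        have : 4 * t * (p x + t)^3 - ((p x + t)^4 - p x ^ 4) = 6 * p x ^ 2 * t ^ 2 + 8 * p x * t ^ 3 + 3 * t ^ 4 := by ring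
        have : 0 ≤ 6 * p x ^ 2 * t ^ 2 + 8 * p x * t ^ 3 + 3 * t ^ 4 := by positivity
        linarith
      have u2 : g x ^ 3 ≤ (q * M) ^ 3 := pow_le_pow_left₀ hgx (hgM x) 3
      have u3 := mul_le_mul_of_nonneg_left u2 (show 0 ≤ 4 * (κ * q * h x) by positivity)
      have u4 : 4 * (κ * q * h x) * (q * M) ^ 3 = 4 * κ * M ^ 3 * q ^ 4 * h x := by ring
      linarith
    have e : P x ^ 2 = 9 * h x ^ 2 + 6 * (c * d) * h x * g x ^ 2 + (c * d) ^ 2 * g x ^ 4 := by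
      simp only [hP]; ring
    have t4 := mul_le_mul_of_nonneg_left t3 (show 0 ≤ (c * d) ^ 2 by positivity)
    have t5 := mul_le_mul_of_nonneg_left t2 (show 0 ≤ 6 * (c * d) * h x by positivity)
    rw [e]
    linarith
  refine (sum_le_sum fun x _ => s2 x).trans ?_
  rw [sum_add_distrib, sum_add_distrib, ← mul_sum, ← mul_sum, ← mul_sum, sum_add_distrib, ← mul_sum]
  have t1 : 9 * H * ∑ x, h x ≤ 9 * H ^ 2 := by nlinarith
  have t2 : 6 * (c * d * (q * M) ^ 2) * ∑ x, h x ≤ 6 * (c * d * (q * M) ^ 2) * H :=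
    mul_le_mul_of_nonneg_left hH (by positivity)
  have t3 : 4 * κ * M ^ 3 * q ^ 4 * ∑ x, h x ≤ 4 * κ * M ^ 3 * q ^ 4 * H :=
    mul_le_mul_of_nonneg_left hH (by positivity)
  have t4 := mul_le_mul_of_nonneg_left t3 (show 0 ≤ (c * d) ^ 2 by positivity)
  linarith

end domsum

section snake
variable {n : ℕ}

/-- The two literals of the base variable of a snake. -/
def xl (x : Lit n) (j : Bool) : Lit n := if j then ng x else x

lemma ng_xl (x : Lit n) (j : Bool) : ng (xl x j) = xl x (!j) := by cases j <;> simp [xl]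
@[simp] lemma xl_fst (x : Lit n) (j : Bool) : (xl x j).1 = x.1 := by cases j <;> simp [xl]

/-- Snakes: a base literal and two paths of inner literals. -/
abbrev Snake (n k : ℕ) := Lit n × (Bool → Fin k → Lit n)

/-- Source of an edge. -/
def ssrc {k : ℕ} (τ : Snake n k) (e : Bool × Fin (k+1)) : Lit n :=
  (Fin.cons (xl τ.1 e.1) (τ.2 e.1) : Fin (k+1) → Lit n) e.2

/-- Target of an edge. -/
def sdst {k : ℕ} (τ : Snake n k) (e : Bool × Fin (k+1)) : Lit n :=
  (Fin.snoc (τ.2 e.1) (xl τ.1 (!e.1)) : Fin (k+1) → Lit n) e.2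

/-- All variables of the snake are distinct. -/
def Good {k : ℕ} (τ : Snake n k) : Prop :=
  (∀ j i, (τ.2 j i).1 ≠ τ.1.1) ∧ ∀ j i j' i', (τ.2 j i).1 = (τ.2 j' i').1 → j = j' ∧ i = i'

/-- The edge matrix of a snake. -/
noncomputable def EM {k : ℕ} (τ : Snake n k) : Matrix (Lit n) (Lit n) ℝ := Matrix.of fun a b =>
  ∑ e, ((if ssrc τ e = a ∧ sdst τ e = b then (1:ℝ) else 0) + (if ssrc τ e = ng b ∧ sdst τ e = ng a then 1 else 0))

/-- The potential of a snake. -/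
noncomputable def pot {k : ℕ} (ρ : ℝ) (τ : Snake n k) (y : Lit n) : ℝ :=
  2 * (if τ.1.1 = y.1 then 1 else 0) +
    ∑ j, ∑ i : Fin k, ((if τ.2 j i = y then ρ ^ ((i:ℕ)+1) else 0) + (if τ.2 j i = ng y then ρ ^ (k - (i:ℕ)) else 0))

variable {k : ℕ} (τ : Snake n k)

lemma EM_nonneg (a b : Lit n) : 0 ≤ EM τ a b := by
  simp only [EM, Matrix.of_apply]
  refine sum_nonneg fun e _ => ?_
  split_ifs <;> norm_num

lemma EM_symm (a b : Lit n) : EM τ (ng b) (ng a) = EM τ a b := by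
  simp only [EM, Matrix.of_apply, ng_ng]
  refine sum_congr rfl fun e _ => ?_
  rw [add_comm]

lemma EM_mul (f : Lit n → ℝ) (y : Lit n) : ∑ b, EM τ y b * f b =
    ∑ e, ((if ssrc τ e = y then f (sdst τ e) else 0) + (if sdst τ e = ng y then f (ng (ssrc τ e)) else 0)) := by
  simp only [EM, Matrix.of_apply, sum_mul]
  rw [sum_comm]
  refine sum_congr rfl fun e _ => ?_
  simp only [add_mul, sum_add_distrib]
  congr 1
  · by_cases h : ssrc τ e = y <;> simp [h]
  · have : ∀ b, (ssrc τ e = ng b) ↔ (ng (ssrc τ e) = b) := fun b =>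
      ⟨fun h => by rw [h, ng_ng], fun h => by rw [← h, ng_ng]⟩
    simp only [this]
    by_cases h : sdst τ e = ng y <;> simp [h]

lemma xl_sum (x y : Lit n) : ∑ j, (if xl x j = y then (1:ℝ) else 0) = if x.1 = y.1 then 1 else 0 := by
  rw [Fintype.sum_bool]
  simp only [xl, if_true, Bool.false_eq_true, if_false]
  by_cases h : x.1 = y.1
  · rcases eq_or_ng h with rfl | rfl
    · simp [ng_ne]
    · simp [(ng_ne y)]
  · have h1 : ng x ≠ y := fun h' => h (by rw [← h']; rfl)
    have h2 : x ≠ y := fun h' => h (by rw [h'])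
    simp [h, h1, h2]

lemma edge_sum (w1 w2 : ℕ → ℝ) (y : Lit n) :
    ∑ e : Bool × Fin (k+1), ((if ssrc τ e = y then w1 e.2 else 0) + (if sdst τ e = ng y then w2 e.2 else 0))
    = (w1 0 + w2 k) * (if τ.1.1 = y.1 then 1 else 0) +
      ∑ j, ∑ i : Fin k, ((if τ.2 j i = y then w1 (i+1) else 0) + (if τ.2 j i = ng y then w2 i else 0)) := by
  rw [Fintype.sum_prod_type]
  have : ∀ j : Bool, ∑ i : Fin (k+1), ((if ssrc τ (j, i) = y then w1 i else 0) + (if sdst τ (j, i) = ng y then w2 i else 0))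
      = (w1 0 + w2 k) * (if xl τ.1 j = y then 1 else 0) +
      ∑ i : Fin k, ((if τ.2 j i = y then w1 (i+1) else 0) + (if τ.2 j i = ng y then w2 i else 0)) := by
    intro j
    rw [sum_add_distrib, Fin.sum_univ_succ,
      Fin.sum_univ_castSucc (f := fun i => if sdst τ (j, i) = ng y then w2 i else 0)]
    simp only [ssrc, sdst, Fin.cons_zero, Fin.cons_succ, Fin.snoc_castSucc, Fin.snoc_last, Fin.val_zero,
      Fin.val_succ, Fin.val_castSucc, Fin.val_last]
    have h1 : (xl τ.1 (!j) = ng y) ↔ xl τ.1 j = y := by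
      rw [← ng_xl]; exact ⟨ng_inj, fun h => by rw [h]⟩
    simp only [h1, sum_add_distrib]
    by_cases h : xl τ.1 j = y <;> simp [h] <;> ring
  simp only [this]
  rw [sum_add_distrib, ← mul_sum, xl_sum]

variable {ρ : ℝ}

lemma pot_nonneg (hρ : 1 ≤ ρ) (y : Lit n) : 0 ≤ pot ρ τ y := by
  have h0 : 0 ≤ ρ := by linarith
  unfold pot
  refine add_nonneg (by split_ifs <;> norm_num) (sum_nonneg fun j _ => sum_nonneg fun i _ => ?_)
  split_ifs <;> positivity

lemma pot_one (hρ : 1 ≤ ρ) (y : Lit n) : ∑ b, EM τ y b ≤ pot ρ τ y := by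
  have h := EM_mul τ (fun _ => 1) y
  simp only [mul_one] at h
  rw [h, edge_sum τ (fun _ => 1) (fun _ => 1) y]
  unfold pot
  refine add_le_add (by norm_num) (sum_le_sum fun j _ => sum_le_sum fun i _ => add_le_add ?_ ?_)
  · split_ifs
    · exact one_le_pow₀ hρ
    · exact le_rfl
  · split_ifs
    · exact one_le_pow₀ hρ
    · exact le_rfl

lemma pot_inner (hG : Good τ) (j : Bool) (i : Fin k) : pot ρ τ (τ.2 j i) = ρ ^ ((i:ℕ)+1) ∧
    pot ρ τ (ng (τ.2 j i)) = ρ ^ (k - (i:ℕ)) := by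
  have h1 : ∀ j' i', τ.2 j' i' = τ.2 j i ↔ (j' = j ∧ i' = i) := fun j' i' =>
    ⟨fun h => hG.2 _ _ _ _ (congrArg Prod.fst h), fun h => by rw [h.1, h.2]⟩
  have h2 : ∀ j' i', τ.2 j' i' ≠ ng (τ.2 j i) := fun j' i' h => by
    obtain ⟨rfl, rfl⟩ := hG.2 j' i' j i (by rw [h]; rfl)
    exact ng_ne _ h.symm
  have h3 : τ.1.1 ≠ (τ.2 j i).1 := fun h => hG.1 j i h.symm
  constructor
  · simp only [pot, h1, h2, h3, if_false]
    rw [sum_eq_single j]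
    · rw [sum_eq_single i] <;> simp +contextual
    · simp +contextual
    · simp
  · simp only [pot, ng_ng, ng_fst, h1, h2, h3, if_false]
    rw [sum_eq_single j]
    · rw [sum_eq_single i] <;> simp +contextual
    · simp +contextual
    · simp

lemma pot_end (hG : Good τ) (j : Bool) : pot ρ τ (xl τ.1 j) = 2 := by
  have h1 : ∀ j' i', τ.2 j' i' ≠ xl τ.1 j := fun j' i' h => hG.1 j' i' (by rw [h, xl_fst])
  have h2 : ∀ j' i', τ.2 j' i' ≠ xl τ.1 (!j) := fun j' i' h => hG.1 j' i' (by rw [h, xl_fst])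
  simp [pot, ng_xl, h1, h2]

lemma pot_dst (hG : Good τ) (h2 : 2 ≤ ρ ^ (k+1)) (e : Bool × Fin (k+1)) :
    pot ρ τ (sdst τ e) ≤ ρ ^ ((e.2:ℕ)+1) := by
  obtain ⟨j, e⟩ := e
  refine Fin.lastCases ?_ (fun i => ?_) e
  · simp only [sdst, Fin.snoc_last, pot_end τ hG]
    simpa using h2
  · simp only [sdst, Fin.snoc_castSucc, (pot_inner τ hG _ _).1]
    simp

lemma pot_src (hG : Good τ) (h2 : 2 ≤ ρ ^ (k+1)) (e : Bool × Fin (k+1)) :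
    pot ρ τ (ng (ssrc τ e)) ≤ ρ ^ (k + 1 - (e.2:ℕ)) := by
  obtain ⟨j, e⟩ := e
  refine Fin.cases ?_ (fun i => ?_) e
  · simp only [ssrc, Fin.cons_zero, ng_xl, pot_end τ hG]
    simpa using h2
  · simp only [ssrc, Fin.cons_succ, (pot_inner τ hG _ _).2]
    simp

lemma pot_mul (hG : Good τ) (hρ : 1 ≤ ρ) (h2 : 2 ≤ ρ ^ (k+1)) (y : Lit n) :
    ∑ b, EM τ y b * pot ρ τ b ≤ ρ * pot ρ τ y := by
  rw [EM_mul]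
  have : ∀ e : Bool × Fin (k+1), ((if ssrc τ e = y then pot ρ τ (sdst τ e) else 0) +
      (if sdst τ e = ng y then pot ρ τ (ng (ssrc τ e)) else 0)) ≤
      ((if ssrc τ e = y then (fun i => ρ ^ (i+1)) (e.2:ℕ) else 0) +
        (if sdst τ e = ng y then (fun i => ρ ^ (k+1-i)) (e.2:ℕ) else 0)) := by
    intro e
    refine add_le_add ?_ ?_
    · split_ifs
      · exact pot_dst τ hG h2 e
      · exact le_rfl
    · split_ifs
      · exact pot_src τ hG h2 e
      · exact le_rfl
  refine (sum_le_sum fun e _ => this e).trans (le_of_eq ?_)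
  rw [edge_sum τ (fun i => ρ ^ (i+1)) (fun i => ρ ^ (k+1-i)) y]
  unfold pot
  rw [mul_add, mul_sum]
  congr 1
  · simp; ring
  · refine sum_congr rfl fun j _ => ?_
    rw [mul_sum]
    refine sum_congr rfl fun i _ => ?_
    have : k + 1 - (i:ℕ) = (k - i) + 1 := by have := i.2; omega
    rw [mul_add]
    simp only [this, pow_succ]
    congr 1 <;> split_ifs <;> ring

lemma pot_sum (hρ : 1 ≤ ρ) (h3 : ρ ^ k ≤ 3) : ∑ y, pot ρ τ y ≤ 12 * (k+1) := by
  unfold pot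
  rw [sum_add_distrib, sum_comm]
  have e1 : ∑ y : Lit n, 2 * (if τ.1.1 = y.1 then (1:ℝ) else 0) = 4 := by
    rw [Fintype.sum_prod_type]
    simp [← mul_sum]; norm_num
  have hp : ∀ i, i ≤ k → ρ ^ i ≤ 3 := fun i hi => (pow_le_pow_right₀ hρ hi).trans h3
  have e2 : ∀ j : Bool, ∑ y : Lit n, ∑ i : Fin k, ((if τ.2 j i = y then ρ ^ ((i:ℕ)+1) else 0) + (if τ.2 j i = ng y then ρ ^ (k - (i:ℕ)) else 0)) ≤ 6 * k := by
    intro j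
    rw [sum_comm]
    have : ∀ i : Fin k, ∑ y : Lit n, ((if τ.2 j i = y then ρ ^ ((i:ℕ)+1) else 0) + (if τ.2 j i = ng y then ρ ^ (k - (i:ℕ)) else 0)) ≤ 6 := by
      intro i
      have hh : ∀ y, (τ.2 j i = ng y) ↔ (ng (τ.2 j i) = y) := fun b =>
        ⟨fun h => by rw [h, ng_ng], fun h => by rw [← h, ng_ng]⟩
      simp only [hh, sum_add_distrib, sum_ite_eq, mem_univ, if_true]
      have := hp (i+1) (by have := i.2; omega)
      have := hp (k-i) (by omega)
      linarith
    refine (sum_le_sum fun i _ => this i).trans ?_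
    simp; linarith
  rw [e1]
  refine (add_le_add_right (sum_le_sum fun j _ => e2 j) _).trans ?_
  simp
  linarith
end snake

section unsat
variable {n m k : ℕ} {p : ℕ → ℝ}

lemma snake_unsat {Φ : Fin m → Lit n × Lit n} (τ : Snake n k) (f : Bool × Fin (k+1) → Fin m)
    (hf : ∀ e, Φ (f e) ∈ Bs (ssrc τ e) (sdst τ e)) : ¬ Sat2 Φ := by
  rintro ⟨a, ha⟩
  have hB : ∀ (s t : Lit n) (j : Fin m), Φ j ∈ Bs s t → (a s.1 = s.2 → a t.1 = t.2) := by
    intro s t j hj hs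
    have h := ha j
    simp only [Bs, mem_insert, mem_singleton] at hj
    rcases hj with hj | hj <;> rw [hj] at h <;> simp only [ng] at h
    · rcases h with h | h
      · rw [hs] at h; cases s.2 <;> simp at h
      · exact h
    · rcases h with h | h
      · exact h
      · rw [hs] at h; cases s.2 <;> simp at h
  have gen : ∀ s t : Lit n, Relation.ReflTransGen (fun s t : Lit n => a s.1 = s.2 → a t.1 = t.2) s t →
      (a s.1 = s.2 → a t.1 = t.2) := by
    intro s t h
    induction h with
    | refl => exact id
    | tail _ h ih => exact fun hj => h (ih hj)
  have hpath : ∀ j, a (xl τ.1 j).1 = (xl τ.1 j).2 → a (xl τ.1 (!j)).1 = (xl τ.1 (!j)).2 := by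
    intro j hj
    have := path_rel (fun s t : Lit n => a s.1 = s.2 → a t.1 = t.2) k (xl τ.1 j) (xl τ.1 (!j)) (τ.2 j)
      (fun e => hB _ _ _ (hf (j, e)))
    exact gen _ _ this hj
  have h0 := hpath false
  have h1 := hpath true
  simp only [xl, ng] at h0 h1
  simp at h0 h1
  cases h : a τ.1.1 <;> cases h' : τ.1.2 <;> simp_all

/-- Restricted weights. -/
noncomputable def pt (n L : ℕ) (p : ℕ → ℝ) (a : Lit n) : ℝ := if L ≤ (a.1 : ℕ) then p a.1 else 0

/-- Snakes with distinct variables of index at least `L`. -/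
noncomputable def SS (n k L : ℕ) : Finset (Snake n k) :=
  univ.filter fun τ => Good τ ∧ L ≤ (τ.1.1 : ℕ) ∧ ∀ j i, L ≤ ((τ.2 j i).1 : ℕ)

lemma ssrc_prop (P : Lit n → Prop) (τ : Snake n k) (h1 : ∀ j, P (xl τ.1 j)) (h2 : ∀ j i, P (τ.2 j i))
    (e : Bool × Fin (k+1)) : P (ssrc τ e) ∧ P (sdst τ e) := by
  obtain ⟨j, e⟩ := e
  constructor
  · refine Fin.cases ?_ (fun i => ?_) e
    · simpa [ssrc] using h1 j
    · simpa [ssrc] using h2 j i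
  · refine Fin.lastCases ?_ (fun i => ?_) e
    · simpa [sdst] using h1 (!j)
    · simpa [sdst] using h2 j i

lemma SS_D (hp : ∀ i, i < n → 0 ≤ p i) (hs : ∑ i ∈ range n, p i ^ 2 < 1) (L : ℕ) (τ : Snake n k) :
    ∑ τ' ∈ SS n k L, ∏ e', ((m:ℝ) * (∑ c ∈ Bs (ssrc τ' e') (sdst τ' e'), clauseProb2 n p c)
      + ∑ e, if Bs (ssrc τ e) (sdst τ e) = Bs (ssrc τ' e') (sdst τ' e') then (1:ℝ) else 0) ≤
    ∑ x, ((Matrix.of fun a b => (m * Cconst n p / 2) * pt n L p a * pt n L p b + EM τ a b) ^ (k+1)) x (ng x) *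
      ((Matrix.of fun a b => (m * Cconst n p / 2) * pt n L p a * pt n L p b + EM τ a b) ^ (k+1)) (ng x) x := by
  set A : Matrix (Lit n) (Lit n) ℝ :=
    Matrix.of fun a b => (m * Cconst n p / 2) * pt n L p a * pt n L p b + EM τ a b with hA
  have hC : 0 ≤ Cconst n p := inv_nonneg.mpr (by linarith)
  have hpt : ∀ a, 0 ≤ pt n L p a := fun a => by
    unfold pt; split_ifs
    · exact hp _ a.1.2
    · exact le_rfl
  have hA0 : ∀ a b, 0 ≤ A a b := fun a b => by
    simp only [hA, Matrix.of_apply]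
    have := hpt a; have := hpt b; have := EM_nonneg τ a b; positivity
  have step : ∀ τ' ∈ SS n k L, ∏ e', ((m:ℝ) * (∑ c ∈ Bs (ssrc τ' e') (sdst τ' e'), clauseProb2 n p c)
      + ∑ e, if Bs (ssrc τ e) (sdst τ e) = Bs (ssrc τ' e') (sdst τ' e') then (1:ℝ) else 0) ≤
      ∏ e', A (ssrc τ' e') (sdst τ' e') := by
    intro τ' hτ'
    simp only [SS, mem_filter, mem_univ, true_and] at hτ'
    obtain ⟨_, hx, hu⟩ := hτ'
    refine prod_le_prod (fun e' _ => ?_) fun e' _ => ?_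
    · refine add_nonneg (mul_nonneg (Nat.cast_nonneg _) (sum_nonneg fun c _ => clauseProb_nonneg hp hs c)) ?_
      exact sum_nonneg fun e _ => by split_ifs <;> norm_num
    · obtain ⟨v1, v2⟩ := ssrc_prop (fun a => L ≤ (a.1:ℕ)) τ' (fun j => by simpa using hx) hu e'
      simp only [hA, Matrix.of_apply]
      refine add_le_add ?_ ?_
      · simp only [pt, v1, v2, if_true]
        calc _ ≤ (m:ℝ) * (Cconst n p / 2 * p (ssrc τ' e').1 * p (sdst τ' e').1) :=
              mul_le_mul_of_nonneg_left (Bs_mass_le hp hs _ _) (Nat.cast_nonneg _)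
          _ = _ := by ring
      · simp only [EM, Matrix.of_apply]
        refine sum_le_sum fun e _ => ?_
        by_cases h : Bs (ssrc τ e) (sdst τ e) = Bs (ssrc τ' e') (sdst τ' e')
        · rw [if_pos h]
          rcases Bs_eq h with h' | h'
          · rw [if_pos h']
            split_ifs <;> norm_num
          · rw [if_pos h']
            split_ifs <;> norm_num
        · rw [if_neg h]
          split_ifs <;> norm_num
  refine (sum_le_sum step).trans ?_
  refine (sum_le_sum_of_subset_of_nonneg (subset_univ _) fun τ' _ _ => prod_nonneg fun e _ => hA0 _ _).trans (le_of_eq ?_)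
  rw [Fintype.sum_prod_type]
  refine sum_congr rfl fun x _ => ?_
  have h1 : ∀ u : Bool → Fin k → Lit n, ∏ e, A (ssrc (x, u) e) (sdst (x, u) e) =
      ∏ j, (fun (j : Bool) (v : Fin k → Lit n) => ∏ e : Fin (k+1), A ((Fin.cons (xl x j) v : Fin (k+1) → Lit n) e)
        ((Fin.snoc v (xl x (!j)) : Fin (k+1) → Lit n) e)) j (u j) := by
    intro u
    rw [Fintype.prod_prod_type]
    rfl
  simp_rw [h1]
  have h2 := Fintype.prod_sum (fun (j : Bool) (v : Fin k → Lit n) => ∏ e : Fin (k+1), A ((Fin.cons (xl x j) v : Fin (k+1) → Lit n) e)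
        ((Fin.snoc v (xl x (!j)) : Fin (k+1) → Lit n) e))
  rw [← h2, Fintype.prod_bool]
  simp only [path_sum]
  rw [mul_comm]
  simp [xl]

lemma SS_N (hp : ∀ i, i < n → 0 ≤ p i) (hs : ∑ i ∈ range n, p i ^ 2 < 1) (L : ℕ) (hk : 1 ≤ k) (q : ℝ)
    (hq : ∀ a, pt n L p a ≤ q) (hW : (1 + 2 * k) * (2 * q ^ 2) ≤ ∑ a, pt n L p a ^ 2) :
    (Cconst n p / 2) ^ (2 * (k+1)) * ((∑ a, pt n L p a ^ 4) *
      (∑ a, pt n L p a ^ 2 - (1 + 2 * k) * (2 * q ^ 2)) ^ (2 * k)) ≤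
    ∑ τ ∈ SS n k L, ∏ e, ∑ c ∈ Bs (ssrc τ e) (sdst τ e), clauseProb2 n p c := by
  have hC : 0 ≤ Cconst n p := inv_nonneg.mpr (by linarith)
  have hpt : ∀ a, 0 ≤ pt n L p a := fun a => by
    unfold pt; split_ifs
    · exact hp _ a.1.2
    · exact le_rfl
  have mass : ∀ τ ∈ SS n k L, ∏ e, ∑ c ∈ Bs (ssrc τ e) (sdst τ e), clauseProb2 n p c =
      (Cconst n p / 2) ^ (2 * (k+1)) * (pt n L p τ.1 ^ 4 * ∏ i : Bool × Fin k, pt n L p (τ.2 i.1 i.2) ^ 2) := by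
    intro τ hτ
    simp only [SS, mem_filter, mem_univ, true_and] at hτ
    obtain ⟨hG, hx, hu⟩ := hτ
    have e1 : ∀ e, ∑ c ∈ Bs (ssrc τ e) (sdst τ e), clauseProb2 n p c =
        Cconst n p / 2 * (pt n L p (ssrc τ e) * pt n L p (sdst τ e)) := by
      intro e
      obtain ⟨v1, v2⟩ := ssrc_prop (fun a => L ≤ (a.1:ℕ)) τ (fun j => by simpa using hx) hu e
      rw [Bs_mass_eq]
      · simp only [pt, v1, v2, if_true]; ring
      · refine cons_snoc_ne Prod.fst k hk (xl τ.1 e.1) (xl τ.1 (!e.1)) (τ.2 e.1) ?_ ?_ ?_ e.2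
        · intro i i' h; exact (hG.2 _ _ _ _ h).2
        · intro i; rw [xl_fst]; exact hG.1 _ _
        · intro i; rw [xl_fst]; exact hG.1 _ _
    simp only [e1]
    rw [prod_mul_distrib, prod_const, card_univ]
    have hcard : Fintype.card (Bool × Fin (k+1)) = 2 * (k+1) := by simp
    rw [hcard]
    congr 1
    rw [Fintype.prod_prod_type, Fintype.prod_prod_type]
    have e2 : ∀ j : Bool, ∏ e : Fin (k+1), (pt n L p (ssrc τ (j, e)) * pt n L p (sdst τ (j, e)))
        = pt n L p τ.1 ^ 2 * ∏ i, pt n L p (τ.2 j i) ^ 2 := by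
      intro j
      have := prod_cons_snoc (pt n L p) k (xl τ.1 j) (xl τ.1 (!j)) (τ.2 j)
      refine Eq.trans this ?_
      have h3 : ∀ j, pt n L p (xl τ.1 j) = pt n L p τ.1 := fun j => by simp [pt]
      rw [h3, h3, sq]
    simp only [e2, prod_mul_distrib, prod_const, card_univ, Fintype.card_bool]
    ring
  rw [sum_congr rfl mass, ← mul_sum]
  refine mul_le_mul_of_nonneg_left ?_ (by positivity)
  rw [SS, sum_filter, sum_mul]
  refine le_trans ?_ (Fintype.sum_prod_type _).ge
  refine sum_le_sum fun x _ => ?_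
  by_cases hx : L ≤ (x.1:ℕ)
  swap
  · have : pt n L p x = 0 := by simp [pt, hx]
    refine le_of_eq_of_le (by rw [this]; simp) (sum_nonneg fun u _ => ?_)
    split_ifs
    · exact mul_nonneg (by positivity) (prod_nonneg fun i _ => by positivity)
    · exact le_rfl
  have hw := inj_weight' (I := Bool × Fin k) (Prod.fst : Lit n → Fin n) (fun a => pt n L p a ^ 2) (fun a => by positivity)
    (2 * q ^ 2) (by positivity) (by
      intro y
      rw [Fintype.sum_prod_type, sum_eq_single y]
      · simp only [if_true, Fintype.sum_bool]
        have := hq (y, true)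
        have e : pt n L p (y, false) = pt n L p (y, true) := rfl
        have := pow_le_pow_left₀ (hpt _) this 2
        rw [e]; linarith
      · intro b _ hb; simp [hb]
      · simp) {x.1} (by
      simp only [card_singleton, Fintype.card_prod, Fintype.card_bool, Fintype.card_fin]
      push_cast
      linarith)
  simp only [card_singleton, Fintype.card_prod, Fintype.card_bool, Fintype.card_fin] at hw
  push_cast at hw
  refine (mul_le_mul_of_nonneg_left hw (show 0 ≤ pt n L p x ^ 4 by positivity)).trans ?_
  rw [mul_sum]
  refine le_trans ?_ ((Equiv.curry Bool (Fin k) (Lit n)).sum_comp _).le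
  refine sum_le_sum fun u _ => ?_
  have hnn : 0 ≤ ∏ i, pt n L p (u i) ^ 2 := prod_nonneg fun i _ => by positivity
  have he : ∀ j i, (Equiv.curry Bool (Fin k) (Lit n)) u j i = u (j, i) := fun _ _ => rfl
  simp only [he]
  by_cases hu : ∀ i, L ≤ ((u i).1 : ℕ)
  · by_cases h : Function.Injective (Prod.fst ∘ u) ∧ ∀ i, (u i).1 ∉ ({x.1} : Finset (Fin n))
    · rw [if_pos h, if_pos]
      refine ⟨⟨fun j i h' => h.2 (j, i) (by simpa using h'), fun j i j' i' h' => ?_⟩, hx, fun j i => hu _⟩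
      have := h.1 (a₁ := (j, i)) (a₂ := (j', i')) h'
      simpa using this
    · rw [if_neg h, mul_zero]
      split_ifs
      · exact mul_nonneg (by positivity) hnn
      · exact le_rfl
  · push Not at hu
    obtain ⟨i, hi⟩ := hu
    have hz : ∏ i, pt n L p (u i) ^ 2 = 0 := by
      refine prod_eq_zero (mem_univ i) ?_
      simp [pt, hi]
    rw [hz]
    simp

set_option maxHeartbeats 1000000 in
lemma unsat_ge (hp : ∀ i, i < n → 0 ≤ p i) (h1 : ∑ i ∈ range n, p i = 1)
    (hs : ∑ i ∈ range n, p i ^ 2 < 1) (L : ℕ) (hk : 1 ≤ k) (q c b H M d κ : ℝ) (hq0 : 0 ≤ q)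
    (hq : ∀ a, pt n L p a ≤ q) (hW : (1 + 2 * k) * (2 * q ^ 2) ≤ ∑ a, pt n L p a ^ 2)
    (hc : c = m * Cconst n p / 2) (hκ : κ = ((k:ℝ)+1)^2) (hH : H = 12 * (k+1)) (hM : M = 1 + κ * H)
    (hd : d = b ^ k * (1 + 3 * k / κ)) (hb1 : 1 + 1/((k:ℝ)+1) + 1/κ ≤ b)
    (hb2 : c * (∑ y, pt n L p y ^ 2 + κ * q ^ 2 * H) ≤ b) :
    (m.descFactorial (2 * (k+1)) : ℝ) * ((Cconst n p / 2) ^ (2 * (k+1)) * ((∑ a, pt n L p a ^ 4) *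
      (∑ a, pt n L p a ^ 2 - (1 + 2 * k) * (2 * q ^ 2)) ^ (2 * k))) ≤
    ((c * d) ^ 2 * (∑ y, pt n L p y ^ 4 + 4 * κ * H * M ^ 3 * q ^ 4) + 6 * H * (c * d * (q * M) ^ 2) + 9 * H ^ 2)
      * probUnsat2 n m p := by
  have hC : 0 ≤ Cconst n p := inv_nonneg.mpr (by linarith)
  have hpt : ∀ a, 0 ≤ pt n L p a := fun a => by
    unfold pt; split_ifs
    · exact hp _ a.1.2
    · exact le_rfl
  have hc0 : 0 ≤ c := by rw [hc]; positivity
  have hκ0 : 0 < κ := by rw [hκ]; positivity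
  have hH0 : 0 ≤ H := by rw [hH]; positivity
  have hM0 : 0 ≤ M := by rw [hM]; positivity
  have hb0 : 0 ≤ b := le_trans (by positivity) hb1
  have hd0 : 0 ≤ d := by rw [hd]; positivity
  set ρ : ℝ := 1 + 1/((k:ℝ)+1) with hρd
  have hρ : 1 ≤ ρ := by rw [hρd]; have : 0 ≤ 1/((k:ℝ)+1) := by positivity
                        linarith
  have hρ2 : 2 ≤ ρ ^ (k+1) := by
    have := one_add_mul_le_pow (a := 1/((k:ℝ)+1)) (le_trans (by norm_num) (show (0:ℝ) ≤ 1/((k:ℝ)+1) by positivity)) (k+1)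
    refine le_trans (le_of_eq ?_) this
    push_cast
    field_simp
    norm_num
  have hρ3 : ρ ^ k ≤ 3 := by
    have h2 : ρ ≤ Real.exp (1/((k:ℝ)+1)) := by rw [hρd, add_comm]; exact Real.add_one_le_exp _
    calc ρ ^ k ≤ ρ ^ (k+1) := pow_le_pow_right₀ hρ (by omega)
      _ ≤ Real.exp (1/((k:ℝ)+1)) ^ (k+1) := pow_le_pow_left₀ (by linarith) h2 _
      _ = Real.exp 1 := by
          rw [← Real.exp_nat_mul]; congr 1; push_cast; field_simp
      _ ≤ 3 := by have := Real.exp_one_lt_d9; linarith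
  have h0 := clauseProb_nonneg hp hs
  have hs1 := clauseProb_sum h1 hs
  set D := ((c * d) ^ 2 * (∑ y, pt n L p y ^ 4 + 4 * κ * H * M ^ 3 * q ^ 4) + 6 * H * (c * d * (q * M) ^ 2) + 9 * H ^ 2) with hD
  have hD0 : 0 ≤ D := by
    have : 0 ≤ ∑ y, pt n L p y ^ 4 := sum_nonneg fun y _ => by positivity
    positivity
  have hsm := second_moment (m := m) (SS n k L) (clauseProb2 n p) h0 hs1
    (fun τ (e : Bool × Fin (k+1)) => Bs (ssrc τ e) (sdst τ e))
    (fun τ _ τ' _ e e' => Bs_eq_or_disj _ _ _ _) D (by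
      intro τ hτ
      have hG : Good τ := by simp only [SS, mem_filter] at hτ; exact hτ.2.1
      refine (SS_D hp hs L τ).trans ?_
      rw [← hc]
      refine dom_sum (EM τ) (EM_nonneg τ) ng ng_ng (EM_symm τ) (pt n L p) (pot ρ τ) hpt (pot_nonneg τ hρ)
        (fun a => rfl) q κ c ρ b H hq hκ0 hc0 hq0 hρ (pot_one τ hρ) (pot_mul τ hG hρ hρ2) hb1
        ?_ hb2 k hρ3 M d hM hd
      rw [hH]; exact pot_sum τ hρ hρ3)
  have hcard : Fintype.card (Bool × Fin (k+1)) = 2 * (k+1) := by simp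
  rw [hcard] at hsm
  refine (mul_le_mul_of_nonneg_left (SS_N hp hs L hk q hq hW) (Nat.cast_nonneg _)).trans (hsm.trans ?_)
  refine mul_le_mul_of_nonneg_left ?_ hD0
  rw [probUnsat2]
  refine sum_le_sum fun Φ _ => ?_
  have hnn : 0 ≤ formulaProb2 n m p Φ := prod_nonneg fun j _ => h0 _
  by_cases hU : ¬ Sat2 Φ
  · rw [if_pos hU]
    split_ifs
    · exact le_rfl
    · exact hnn
  · rw [if_neg hU, if_neg]
    · rintro ⟨τ, _, f, hf⟩
      exact hU (snake_unsat τ f hf)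

end unsat

section num

lemma desc_lower (m r : ℕ) (hr : r ≤ m) (hm : 0 < m) :
    (m:ℝ) ^ r * (1 - (r:ℝ)^2 / m) ≤ m.descFactorial r := by
  have hm' : (0:ℝ) < m := by exact_mod_cast hm
  have h1 : ((m + 1 - r : ℕ) : ℝ) ^ r ≤ m.descFactorial r := by
    exact_mod_cast Nat.pow_sub_le_descFactorial m r
  have h2 : (m:ℝ) - r ≤ ((m + 1 - r : ℕ) : ℝ) := by
    rw [Nat.cast_sub (by omega)]; push_cast; linarith
  have hr' : (r:ℝ) ≤ m := by exact_mod_cast hr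
  have h3 : ((m:ℝ) - r) ^ r ≤ ((m + 1 - r : ℕ) : ℝ) ^ r := pow_le_pow_left₀ (by linarith) h2 r
  have h4 : (m:ℝ) - r = m * (1 + -(r/m)) := by field_simp; ring
  have h5 := one_add_mul_le_pow (a := -((r:ℝ)/m)) (by
    have : (r:ℝ)/m ≤ 1 := by rw [div_le_one hm']; exact hr'
    linarith) r
  refine le_trans ?_ (h3.trans h1)
  rw [h4, mul_pow]
  refine mul_le_mul_of_nonneg_left (le_trans (le_of_eq ?_) h5) (by positivity)
  ring

variable {n m k : ℕ} {p : ℕ → ℝ}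

set_option maxHeartbeats 2000000 in
lemma unsat_num (hn : 1 ≤ n) (hp : ∀ i, i < n → 0 ≤ p i) (h1 : ∑ i ∈ range n, p i = 1)
    (hs : ∑ i ∈ range n, p i ^ 2 < 1) (L : ℕ) (hk : 1 ≤ k) (q W S4 K l Lr : ℝ) (hq0 : 0 ≤ q)
    (hq : ∀ a, pt n L p a ≤ q) (hW : W = ∑ a, pt n L p a ^ 2) (hS : S4 = ∑ a, pt n L p a ^ 4)
    (hK : K = k + 1) (hl : l = m * Cconst n p / 2 * W) (hLr : Lr = L)
    (hqW : 2 * Lr * q ^ 2 ≤ W) (hq4 : Lr * q ^ 4 ≤ 4 * S4) (hWS : W ^ 2 ≤ 2 * n * S4)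
    (hS0 : 0 < S4) (hl1 : 1 + 2 / K ≤ l) (hl2 : n * Lr ≤ l ^ (k+1)) (hLK : 4 * K ^ 2 ≤ Lr)
    (hmK : 2 * (k+1) ≤ m) :
    (1 - 4 * K ^ 2 / m) * (1 - 4 * K ^ 2 / Lr) ≤
      ((Real.exp (6 * K ^ 4 / Lr) * (1 + 3 / K)) ^ 2 * (1 + 192 * K ^ 3 * (1 + 12 * K ^ 3) ^ 3 / Lr)
        + 72 * K * (1 + 12 * K ^ 3) ^ 2 * (Real.exp (6 * K ^ 4 / Lr) * (1 + 3 / K)) / Lr ^ 2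
        + 2592 * K ^ 2 / Lr) * probUnsat2 n m p := by
  have hK2 : 2 ≤ K := by
    have : (1:ℝ) ≤ k := by exact_mod_cast hk
    linarith
  have hK0 : 0 < K := by linarith
  have hLr0 : 0 < Lr := lt_of_lt_of_le (by positivity) hLK
  have hC : 0 < Cconst n p := inv_pos.mpr (by linarith)
  have hn' : (1:ℝ) ≤ n := by exact_mod_cast hn
  have hm0 : 0 < m := by omega
  have hm' : (0:ℝ) < m := by exact_mod_cast hm0
  have hkL : 1 + 2 * (k:ℝ) ≤ Lr := by
    refine le_trans ?_ hLK
    rw [hK]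
    have e : 4 * ((k:ℝ) + 1) ^ 2 - (1 + 2 * k) = 4 * (k:ℝ) ^ 2 + 6 * k + 3 := by ring
    have : 0 ≤ 4 * (k:ℝ) ^ 2 + 6 * k + 3 := by positivity
    linarith
  set c := m * Cconst n p / 2 with hc
  have hc0 : 0 < c := by positivity
  have hl0 : 1 ≤ l := le_trans (by have : 0 ≤ 2 / K := by positivity
                                   linarith) hl1
  have hW0 : 0 < W := by
    by_contra h
    have : c * W ≤ 0 := mul_nonpos_of_nonneg_of_nonpos hc0.le (not_lt.mp h)
    linarith
  set R := Real.exp (6 * K ^ 4 / Lr) * (1 + 3 / K) with hR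
  have hR0 : 0 < R := by positivity
  set M := 1 + 12 * K ^ 3 with hM
  have hM0 : 0 < M := by positivity
  set b := l * (1 + 6 * K ^ 3 / Lr) with hb
  have hcq : 2 * Lr * (c * q ^ 2) ≤ l := by
    rw [hl]
    have := mul_le_mul_of_nonneg_left hqW hc0.le
    linarith
  have hU0 : 0 ≤ probUnsat2 n m p := probUnsat_nonneg hp hs
  have key := unsat_ge (m := m) (k := k) hp h1 hs L hk q c b (12 * K) M (b ^ k * (1 + 3 * k / K^2)) (K^2)
    hq0 hq (by
      rw [← hW]
      refine le_trans ?_ hqW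
      have h3 : (1 + 2 * (k:ℝ)) ≤ Lr := hkL
      have := mul_le_mul_of_nonneg_right h3 (show 0 ≤ 2 * q ^ 2 by positivity)
      linarith) hc (by rw [hK]) (by rw [hK]) (by rw [hM]; ring) rfl (by
      rw [← hK]
      refine le_trans ?_ (show l ≤ b by rw [hb]; have : 0 ≤ l * (6 * K ^ 3 / Lr) := by positivity
                                        rw [mul_add, mul_one]; linarith)
      refine le_trans ?_ hl1
      have : 1 / K ^ 2 ≤ 1 / K := by
        apply one_div_le_one_div_of_le hK0; exact le_self_pow₀ (by linarith) (by norm_num)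
      have e : 2 / K = 1 / K + 1 / K := by ring
      rw [e]; linarith) (by
      rw [← hW, mul_add, ← hl, hb]
      have : 12 * K ^ 3 * (c * q ^ 2) ≤ l * (6 * K ^ 3 / Lr) := by
        rw [mul_div_assoc', le_div_iff₀ hLr0]
        have := mul_le_mul_of_nonneg_left hcq (show 0 ≤ 6 * K ^ 3 by positivity)
        linarith
      rw [mul_add l, mul_one]
      linarith)
  rw [← hW, ← hS] at key
  set d := b ^ k * (1 + 3 * k / K^2) with hd
  have hd0 : 0 ≤ d := by positivity
  have hdR : d ≤ R * l ^ k := by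
    rw [hd, hb, mul_pow, hR]
    have e1 : (1 + 6 * K ^ 3 / Lr) ^ k ≤ Real.exp (6 * K ^ 4 / Lr) := by
      calc (1 + 6 * K ^ 3 / Lr) ^ k ≤ Real.exp (6 * K ^ 3 / Lr) ^ k := by
            refine pow_le_pow_left₀ (by positivity) ?_ k
            rw [add_comm]; exact Real.add_one_le_exp _
        _ = Real.exp (k * (6 * K ^ 3 / Lr)) := by rw [← Real.exp_nat_mul]
        _ ≤ _ := by
            apply Real.exp_le_exp.mpr
            have : (k:ℝ) ≤ K := by linarith
            calc (k:ℝ) * (6 * K ^ 3 / Lr) ≤ K * (6 * K ^ 3 / Lr) := mul_le_mul_of_nonneg_right this (by positivity)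
              _ = _ := by ring
    have e2 : 1 + 3 * k / K ^ 2 ≤ 1 + 3 / K := by
      have : 3 * k / K ^ 2 ≤ 3 / K := by
        rw [div_le_div_iff₀ (by positivity) hK0]
        have h4 : (k:ℝ) ≤ K := by linarith
        have h5 := mul_le_mul_of_nonneg_right h4 (show 0 ≤ 3 * K by positivity)
        calc 3 * (k:ℝ) * K = k * (3 * K) := by ring
          _ ≤ K * (3 * K) := h5
          _ = _ := by ring
      linarith
    calc l ^ k * (1 + 6 * K ^ 3 / Lr) ^ k * (1 + 3 * k / K ^ 2) ≤ l ^ k * Real.exp (6 * K ^ 4 / Lr) * (1 + 3 / K) := by gcongr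
      _ = _ := by ring
  set Mn := c ^ 2 * S4 * l ^ (2 * k) with hMn
  have hMn0 : 0 < Mn := by positivity
  have hN : Mn * ((1 - 4 * K ^ 2 / m) * (1 - 4 * K ^ 2 / Lr)) ≤ (m.descFactorial (2 * (k+1)) : ℝ) * ((Cconst n p / 2) ^ (2 * (k+1)) *
      (S4 * (W - (1 + 2 * k) * (2 * q ^ 2)) ^ (2 * k))) := by
    have d1 := desc_lower m (2 * (k+1)) hmK hm0
    have e0 : ((2 * (k+1) : ℕ):ℝ) ^ 2 = 4 * K ^ 2 := by rw [hK]; push_cast; ring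
    rw [e0] at d1
    have d2 : W ^ (2*k) * (1 - 4 * K ^ 2 / Lr) ≤ (W - (1 + 2 * k) * (2 * q ^ 2)) ^ (2 * k) := by
      have f1 : W * (1 + -((1 + 2*k) / Lr)) ≤ W - (1 + 2 * k) * (2 * q ^ 2) := by
        have : (1 + 2 * k) * (2 * q ^ 2) ≤ W * ((1+2*k)/Lr) := by
          rw [mul_div_assoc', le_div_iff₀ hLr0]
          have := mul_le_mul_of_nonneg_left hqW (show 0 ≤ 1 + 2*(k:ℝ) by positivity)
          linarith
        linarith
      have f2 : (1 + 2*k) / Lr ≤ 1 := by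
        rw [div_le_one hLr0]; exact hkL
      have f3 := one_add_mul_le_pow (a := -((1 + 2*(k:ℝ)) / Lr)) (by linarith) (2*k)
      have f4 : 1 - 4 * K ^ 2 / Lr ≤ 1 + ((2*k : ℕ):ℝ) * -((1 + 2*k) / Lr) := by
        have : ((2*k : ℕ):ℝ) * ((1 + 2*k) / Lr) ≤ 4 * K ^ 2 / Lr := by
          rw [mul_div_assoc']
          apply div_le_div_of_nonneg_right _ hLr0.le
          rw [hK]; push_cast
          have e : 4 * ((k:ℝ) + 1) ^ 2 - 2 * k * (1 + 2 * k) = 6 * k + 4 := by ring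
          have : 0 ≤ 6 * (k:ℝ) + 4 := by positivity
          linarith
        linarith
      calc _ ≤ W ^ (2*k) * (1 + -((1 + 2*(k:ℝ)) / Lr)) ^ (2*k) :=
            mul_le_mul_of_nonneg_left (f4.trans f3) (by positivity)
        _ = (W * (1 + -((1 + 2*k) / Lr))) ^ (2*k) := by rw [mul_pow]
        _ ≤ _ := pow_le_pow_left₀ (mul_nonneg hW0.le (by linarith)) f1 _
    have y0 : 0 ≤ 1 - 4 * K ^ 2 / Lr := by
      have : 4 * K ^ 2 / Lr ≤ 1 := by rw [div_le_one hLr0]; exact hLK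
      linarith
    have e1 : Mn * ((1 - 4 * K ^ 2 / m) * (1 - 4 * K ^ 2 / Lr)) =
        (m ^ (2*(k+1)) * (1 - 4 * K ^ 2 / m)) * ((Cconst n p / 2) ^ (2 * (k+1)) * (S4 * (W ^ (2*k) * (1 - 4 * K ^ 2 / Lr)))) := by
      rw [hMn, hl, mul_pow]
      have : c = m * (Cconst n p / 2) := by rw [hc]; ring
      rw [this, mul_pow, mul_pow]
      ring
    rw [e1]
    calc _ ≤ (m.descFactorial (2 * (k+1)) : ℝ) * ((Cconst n p / 2) ^ (2 * (k+1)) * (S4 * (W ^ (2*k) * (1 - 4 * K ^ 2 / Lr)))) :=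
          mul_le_mul_of_nonneg_right d1 (by positivity)
      _ ≤ _ := by gcongr
  have hcS : l ^ 2 ≤ 2 * n * (c ^ 2 * S4) := by
    rw [hl, mul_pow]
    have := mul_le_mul_of_nonneg_left hWS (show 0 ≤ c ^ 2 by positivity)
    linarith
  have hMl : l ^ (2 * k + 2) ≤ 2 * n * Mn := by
    have := mul_le_mul_of_nonneg_right hcS (show 0 ≤ l ^ (2*k) by positivity)
    rw [hMn, pow_add]; linarith
  have hD : ((c * d) ^ 2 * (S4 + 4 * K ^ 2 * (12 * K) * M ^ 3 * q ^ 4) + 6 * (12 * K) * (c * d * (q * M) ^ 2) + 9 * (12 * K) ^ 2)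
      ≤ Mn * (R ^ 2 * (1 + 192 * K ^ 3 * M ^ 3 / Lr) + 72 * K * M ^ 2 * R / Lr ^ 2 + 2592 * K ^ 2 / Lr) := by
    rw [mul_add Mn, mul_add Mn]
    refine add_le_add (add_le_add ?_ ?_) ?_
    · have g1 : S4 + 4 * K ^ 2 * (12 * K) * M ^ 3 * q ^ 4 ≤ S4 * (1 + 192 * K ^ 3 * M ^ 3 / Lr) := by
        have : 4 * K ^ 2 * (12 * K) * M ^ 3 * q ^ 4 ≤ S4 * (192 * K ^ 3 * M ^ 3 / Lr) := by
          rw [mul_div_assoc', le_div_iff₀ hLr0]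
          have := mul_le_mul_of_nonneg_left hq4 (show 0 ≤ 48 * K ^ 3 * M ^ 3 by positivity)
          linarith
        linarith
      have g2 : d ^ 2 ≤ (R * l ^ k) ^ 2 := pow_le_pow_left₀ hd0 hdR 2
      calc _ = c ^ 2 * d ^ 2 * (S4 + 4 * K ^ 2 * (12 * K) * M ^ 3 * q ^ 4) := by ring
        _ ≤ c ^ 2 * (R * l ^ k) ^ 2 * (S4 * (1 + 192 * K ^ 3 * M ^ 3 / Lr)) := by gcongr
        _ = _ := by rw [hMn]; ring
    · have g1 : Lr * (l ^ (k+1)) ≤ 2 * Mn := by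
        have h3 : n * Lr * l ^ (k+1) ≤ n * (2 * Mn) := by
          calc _ ≤ l ^ (k+1) * l ^ (k+1) := mul_le_mul_of_nonneg_right hl2 (by positivity)
            _ = l ^ (2*k+2) := by ring
            _ ≤ _ := by linarith
        rw [mul_assoc] at h3
        exact le_of_mul_le_mul_left h3 (by linarith)
      have g2 : 2 * Lr ^ 2 * ((c * q ^ 2) * l ^ k) ≤ 2 * Mn := by
        calc _ = Lr * (2 * Lr * (c * q ^ 2) * l ^ k) := by ring
          _ ≤ Lr * (l * l ^ k) := by gcongr
          _ = Lr * l ^ (k+1) := by ring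
          _ ≤ _ := g1
      rw [mul_div_assoc', le_div_iff₀ (by positivity)]
      calc 6 * (12 * K) * (c * d * (q * M) ^ 2) * Lr ^ 2 = 72 * K * M ^ 2 * Lr ^ 2 * (c * q ^ 2) * d := by ring
        _ ≤ 72 * K * M ^ 2 * Lr ^ 2 * (c * q ^ 2) * (R * l ^ k) := by gcongr
        _ = 36 * K * M ^ 2 * R * (2 * Lr ^ 2 * ((c * q ^ 2) * l ^ k)) := by ring
        _ ≤ 36 * K * M ^ 2 * R * (2 * Mn) := by gcongr
        _ = _ := by ring
    · rw [mul_div_assoc', le_div_iff₀ hLr0]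
      have g1 : Lr ≤ 2 * Mn := by
        have h3 : n * Lr ≤ n * (2 * Mn) := by
          calc _ ≤ l ^ (k+1) := hl2
            _ ≤ l ^ (2*k+2) := pow_le_pow_right₀ hl0 (by omega)
            _ ≤ _ := by linarith
        exact le_of_mul_le_mul_left h3 (by linarith)
      have := mul_le_mul_of_nonneg_left g1 (show 0 ≤ 1296 * K ^ 2 by positivity)
      linarith
  have fin := (hN.trans key).trans (mul_le_mul_of_nonneg_right hD hU0)
  rw [mul_assoc Mn] at fin
  exact le_of_mul_le_mul_left fin hMn0

end num

section pl

variable {β : ℝ} {n : ℕ}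

noncomputable def HH (n : ℕ) : ℝ := ∑ i ∈ range n, 1 / ((i:ℝ) + 1)

lemma HH_eq (n : ℕ) : HH n = ((harmonic n : ℚ) : ℝ) := by
  unfold HH harmonic
  push_cast
  simp [one_div]

lemma HH_ge (n : ℕ) : Real.log (n+1) ≤ HH n := by
  rw [HH_eq]; exact_mod_cast log_add_one_le_harmonic n

lemma HH_le (n : ℕ) : HH n ≤ 1 + Real.log n := by
  rw [HH_eq]; exact_mod_cast harmonic_le_one_add_log n

lemma a_pos (hβ : 3 ≤ β) : 0 < (1:ℝ) / (β - 1) := by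
  apply one_div_pos.mpr; linarith

lemma a_le (hβ : 3 ≤ β) : (1:ℝ) / (β - 1) ≤ 1 / 2 := by
  apply one_div_le_one_div_of_le <;> linarith

lemma plSum_ge (hβ : 3 ≤ β) : (n:ℝ) ≤ plSum β n := by
  unfold plSum
  calc (n:ℝ) = ∑ j ∈ range n, (1:ℝ) := by simp
    _ ≤ _ := by
      refine sum_le_sum fun j hj => ?_
      refine Real.one_le_rpow ?_ (a_pos hβ).le
      rw [le_div_iff₀ (by positivity), one_mul]
      exact_mod_cast (mem_range.mp hj)

lemma plSum_pos (hβ : 3 ≤ β) (hn : 1 ≤ n) : 0 < plSum β n :=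
  lt_of_lt_of_le (by exact_mod_cast hn) (plSum_ge hβ)

lemma pl_pos (hβ : 3 ≤ β) (hn : 1 ≤ n) (i : ℕ) : 0 < plProb β n i := by
  have := plSum_pos hβ hn
  have : (0:ℝ) < n := by exact_mod_cast hn
  unfold plProb; positivity

lemma pl_sum (hβ : 3 ≤ β) (hn : 1 ≤ n) : ∑ i ∈ range n, plProb β n i = 1 := by
  unfold plProb
  rw [← sum_div]
  exact div_self (plSum_pos hβ hn).ne'

lemma pl_anti (hβ : 3 ≤ β) (hn : 1 ≤ n) {i j : ℕ} (h : i ≤ j) : plProb β n j ≤ plProb β n i := by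
  have := plSum_pos hβ hn
  have ha := (a_pos hβ).le
  have h' : (i:ℝ) ≤ j := by exact_mod_cast h
  unfold plProb
  gcongr

lemma pl_top (hβ : 3 ≤ β) (hn : 1 ≤ n) : plProb β n 0 ≤ 1 / √n := by
  have hn' : (1:ℝ) ≤ n := by exact_mod_cast hn
  have h1 : plProb β n 0 ≤ √n / n := by
    unfold plProb
    have e : ((n:ℝ) / ((0:ℕ) + 1)) ^ ((1:ℝ) / (β - 1)) ≤ √n := by
      rw [Real.sqrt_eq_rpow]
      simp only [Nat.cast_zero, zero_add, div_one]
      exact Real.rpow_le_rpow_of_exponent_le hn' (a_le hβ)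
    exact div_le_div₀ (Real.sqrt_nonneg _) e (by linarith) (plSum_ge hβ)
  rwa [Real.sqrt_div_self'] at h1

lemma pl_key (hβ : 3 ≤ β) (hn : 1 ≤ n) {i j : ℕ} (h : i ≤ j) :
    plProb β n i ^ 2 * (i + 1) ≤ plProb β n j ^ 2 * (j + 1) := by
  have hS := plSum_pos hβ hn
  have hn' : (0:ℝ) < n := by exact_mod_cast hn
  have e : ∀ i : ℕ, plProb β n i ^ 2 * (i + 1) =
      n / plSum β n ^ 2 * ((n:ℝ) / (i+1)) ^ (2 * ((1:ℝ) / (β - 1)) - 1) := by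
    intro i
    have hi : (0:ℝ) < n / (i+1) := by positivity
    unfold plProb
    rw [Real.rpow_sub hi, Real.rpow_one, mul_comm 2, Real.rpow_mul hi.le]
    rw [div_pow]
    norm_num
    field_simp
  rw [e, e]
  have ha := a_le hβ
  have h' : (i:ℝ) ≤ j := by exact_mod_cast h
  refine mul_le_mul_of_nonneg_left ?_ (by positivity)
  refine Real.rpow_le_rpow_of_nonpos (by positivity) ?_ (by linarith)
  gcongr

noncomputable def sg (β : ℝ) (n : ℕ) : ℝ := ∑ i ∈ range n, plProb β n i ^ 2

lemma sg_ge (hβ : 3 ≤ β) (hn : 1 ≤ n) : plProb β n 0 ^ 2 * HH n ≤ sg β n := by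
  unfold HH sg
  rw [mul_sum]
  refine sum_le_sum fun i _ => ?_
  have := pl_key hβ hn (Nat.zero_le i)
  rw [mul_one_div, div_le_iff₀ (by positivity)]
  simpa using this

lemma sg_pos (hβ : 3 ≤ β) (hn : 1 ≤ n) : 0 < sg β n := by
  unfold sg
  refine sum_pos (fun i _ => by have := pl_pos hβ hn i; positivity) ⟨0, mem_range.mpr hn⟩

lemma sg_le (hβ : 3 ≤ β) (hn : 1 ≤ n) : sg β n ≤ 1 / √n := by
  refine le_trans ?_ (pl_top hβ hn)
  unfold sg
  calc _ ≤ ∑ i ∈ range n, plProb β n 0 * plProb β n i := by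
        refine sum_le_sum fun i _ => ?_
        have := pl_pos hβ hn i
        have := pl_anti hβ hn (Nat.zero_le i)
        rw [pow_two]; gcongr
    _ = _ := by rw [← mul_sum, pl_sum hβ hn, mul_one]

lemma HH_split {L : ℕ} (h : L ≤ n) : HH n = HH L + ∑ i ∈ Ico L n, 1 / ((i:ℝ) + 1) := by
  unfold HH
  exact (sum_range_add_sum_Ico _ h).symm

lemma tail_ge (hβ : 3 ≤ β) (hn : 1 ≤ n) {L : ℕ} (h : L ≤ n) :
    plProb β n L ^ 2 * (L + 1) * (HH n - HH L) ≤ ∑ i ∈ Ico L n, plProb β n i ^ 2 := by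
  rw [HH_split h, add_sub_cancel_left, mul_sum]
  refine sum_le_sum fun i hi => ?_
  have := pl_key hβ hn (mem_Ico.mp hi).1
  rw [mul_one_div, div_le_iff₀ (by positivity)]
  exact this

lemma head_le (hβ : 3 ≤ β) (hn : 1 ≤ n) (L : ℕ) :
    ∑ i ∈ range L, plProb β n i ^ 2 ≤ plProb β n L ^ 2 * (L + 1) * HH L := by
  unfold HH
  rw [mul_sum]
  refine sum_le_sum fun i hi => ?_
  have := pl_key hβ hn (mem_range.mp hi).le
  rw [mul_one_div, le_div_iff₀ (by positivity)]
  exact this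

lemma tail_ratio (hβ : 3 ≤ β) (hn : 1 ≤ n) {L : ℕ} (h : L ≤ n) :
    sg β n * (HH n - HH L) ≤ HH n * ∑ i ∈ Ico L n, plProb β n i ^ 2 := by
  have h1 := head_le hβ hn L
  have h2 := tail_ge hβ hn h
  have h3 : sg β n = ∑ i ∈ range L, plProb β n i ^ 2 + ∑ i ∈ Ico L n, plProb β n i ^ 2 :=
    (sum_range_add_sum_Ico _ h).symm
  have h4 : 0 ≤ HH n - HH L := by
    rw [HH_split h, add_sub_cancel_left]; exact sum_nonneg fun i _ => by positivity
  have h5 : 0 ≤ HH L := by unfold HH; exact sum_nonneg fun i _ => by positivity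
  rw [h3]
  have h6 := mul_le_mul_of_nonneg_right h1 h4
  have h7 := mul_le_mul_of_nonneg_left h2 h5
  nlinarith

lemma tail4 (hβ : 3 ≤ β) (hn : 1 ≤ n) {L : ℕ} (h : 2 * L ≤ n) :
    L * plProb β n L ^ 4 ≤ 4 * ∑ i ∈ Ico L n, plProb β n i ^ 4 := by
  calc (L:ℝ) * plProb β n L ^ 4 = ∑ i ∈ Ico L (2*L), plProb β n L ^ 4 := by
        simp [two_mul]
    _ ≤ ∑ i ∈ Ico L (2*L), 4 * plProb β n i ^ 4 := by
        refine sum_le_sum fun i hi => ?_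
        have h1 := pl_key hβ hn (mem_Ico.mp hi).1
        have h2 : (i:ℝ) + 1 ≤ 2 * (L + 1) := by
          have := (mem_Ico.mp hi).2
          have : (i:ℝ) < 2 * L := by exact_mod_cast this
          linarith
        have h3 : plProb β n L ^ 2 * (L+1) ≤ plProb β n i ^ 2 * 2 * (L+1) := by
          refine h1.trans ?_
          rw [mul_assoc]
          gcongr
        have h4 := le_of_mul_le_mul_right h3 (by positivity)
        have := pow_le_pow_left₀ (by positivity) h4 2
        linarith
    _ ≤ ∑ i ∈ Ico L n, 4 * plProb β n i ^ 4 := by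
        refine sum_le_sum_of_subset_of_nonneg (Ico_subset_Ico_right h) fun i _ _ => ?_
        positivity
    _ = _ := by rw [mul_sum]

lemma pt_sum (L j : ℕ) (hj : j ≠ 0) (p : ℕ → ℝ) : ∑ a, pt n L p a ^ j = 2 * ∑ i ∈ Ico L n, p i ^ j := by
  have h1 : ∑ a : Lit n, pt n L p a ^ j = ∑ x : Fin n × Bool, (if L ≤ (x.1:ℕ) then p x.1 ^ j else 0) := by
    refine sum_congr rfl fun a _ => ?_
    unfold pt
    split_ifs
    · rfl
    · exact zero_pow hj
  rw [h1, Fintype.sum_prod_type]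
  simp only [sum_const, card_univ, Fintype.card_bool, nsmul_eq_mul]
  rw [← mul_sum, Fin.sum_univ_eq_sum_range (fun i => if L ≤ i then p i ^ j else 0), ← sum_filter]
  push_cast
  congr 1
  refine sum_congr ?_ fun _ _ => rfl
  ext i; simp [and_comm]

end pl

section thr

variable {β : ℝ}

lemma logn_top : Tendsto (fun n : ℕ => Real.log (n:ℝ)) atTop atTop :=
  Real.tendsto_log_atTop.comp tendsto_natCast_atTop_atTop

lemma logn1_top : Tendsto (fun n : ℕ => Real.log ((n:ℝ)+1)) atTop atTop :=
  Real.tendsto_log_atTop.comp (tendsto_atTop_add_const_right _ _ tendsto_natCast_atTop_atTop)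

lemma sqrtn_top : Tendsto (fun n : ℕ => √(n:ℝ)) atTop atTop :=
  Real.tendsto_sqrt_atTop.comp tendsto_natCast_atTop_atTop

lemma sg_tendsto (hβ : 3 ≤ β) : Tendsto (sg β) atTop (nhds 0) := by
  refine squeeze_zero' (t₀ := atTop) (g := fun n : ℕ => 1 / √(n:ℝ)) ?_ ?_ ?_
  · filter_upwards [eventually_ge_atTop 1] with n hn using (sg_pos hβ hn).le
  · filter_upwards [eventually_ge_atTop 1] with n hn using sg_le hβ hn
  · simp only [one_div]; exact sqrtn_top.inv_tendsto_atTop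

lemma p0_le (hβ : 3 ≤ β) {n : ℕ} (hn : 1 ≤ n) :
    plProb β n 0 ^ 2 ≤ sg β n / Real.log ((n:ℝ)+1) := by
  have h1 : 0 < Real.log ((n:ℝ)+1) := Real.log_pos (by
    have : (1:ℝ) ≤ n := by exact_mod_cast hn
    linarith)
  rw [le_div_iff₀ h1]
  refine le_trans ?_ (sg_ge hβ hn)
  exact mul_le_mul_of_nonneg_left (HH_ge n) (by positivity)

lemma first_part (hβ : 3 ≤ β) :
    (fun n => plProb β n 0 ^ 2) =o[atTop] fun n => ∑ i ∈ Finset.range n, plProb β n i ^ 2 := by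
  rw [isLittleO_iff]
  intro c hc
  filter_upwards [eventually_ge_atTop 1, logn1_top.eventually_ge_atTop (1/c)] with n hn h1
  have h2 := p0_le hβ hn
  have h3 := sg_pos hβ hn
  change ‖_‖ ≤ c * ‖sg β n‖
  rw [Real.norm_of_nonneg (by positivity), Real.norm_of_nonneg h3.le]
  refine h2.trans ?_
  have h4 : 0 < Real.log ((n:ℝ)+1) := lt_of_lt_of_le (by positivity) h1
  rw [div_le_iff₀ h4]
  have : 1 ≤ c * Real.log ((n:ℝ)+1) := by
    rwa [div_le_iff₀' hc] at h1
  nlinarith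

lemma sat_whp (hβ : 3 ≤ β) (m : ℕ → ℕ) (ε : ℝ) (h0 : 0 < ε) (h1 : ε < 1)
    (h : ∀ᶠ n in atTop, (m n : ℝ) * sg β n ≤ 1 - ε) :
    Tendsto (fun n => probSat2 n (m n) (plProb β n)) atTop (nhds 1) := by
  set r := 1 - ε / 2 with hr
  have hr0 : 0 < r := by linarith
  have hr1 : r < 1 := by linarith
  have hsum : Summable (fun s : ℕ => (s:ℝ) ^ 2 * r ^ s) :=
    summable_pow_mul_geometric_of_norm_lt_one 2 (by rw [Real.norm_of_nonneg hr0.le]; exact hr1)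
  set A := ∑' s : ℕ, (s:ℝ) ^ 2 * r ^ s with hA
  have hA0 : 0 ≤ A := tsum_nonneg fun s => by positivity
  have hsg := (sg_tendsto hβ).eventually (gt_mem_nhds (show 0 < ε / 2 by linarith))
  have hU : Tendsto (fun n => probUnsat2 n (m n) (plProb β n)) atTop (nhds 0) := by
    refine squeeze_zero' (t₀ := atTop) (g := fun n : ℕ => A * (Real.log ((n:ℝ)+1))⁻¹) ?_ ?_ ?_
    · filter_upwards [eventually_ge_atTop 1, hsg] with n hn hs
      exact probUnsat_nonneg (fun i _ => (pl_pos hβ hn i).le) (by unfold sg at hs; linarith)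
    · filter_upwards [eventually_ge_atTop 1, hsg, h, logn1_top.eventually_gt_atTop 0] with n hn hs hm hlog
      have hs' : ∑ i ∈ range n, plProb β n i ^ 2 < 1 := by unfold sg at hs; linarith
      have hC : Cconst n (plProb β n) ≤ 1 / r := by
        unfold Cconst
        rw [← one_div]
        apply one_div_le_one_div_of_le hr0
        unfold sg at hs; linarith
      have hC0 : 0 < Cconst n (plProb β n) := inv_pos.mpr (by linarith)
      have hσ := sg_pos hβ hn
      have hlam : (m n : ℝ) * Cconst n (plProb β n) * sg β n ≤ r := by
        calc _ = (m n : ℝ) * sg β n * Cconst n (plProb β n) := by ring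
          _ ≤ (1 - ε) * (1 / r) := by gcongr
          _ ≤ r := by
            rw [mul_one_div, div_le_iff₀ hr0, hr]; nlinarith
      have hlam0 : 0 ≤ (m n : ℝ) * Cconst n (plProb β n) * sg β n := by positivity
      refine (unsat_le (fun i _ => (pl_pos hβ hn i).le) (pl_sum hβ hn) hs' (fun i _ => pl_anti hβ hn (Nat.zero_le i))).trans ?_
      change _ * _ * _ * ∑ s ∈ range (n+1), ((s:ℝ)^2 * ((m n : ℝ) * Cconst n (plProb β n) * sg β n)^s) ≤ _
      have e1 : ∑ s ∈ range (n+1), ((s:ℝ)^2 * ((m n : ℝ) * Cconst n (plProb β n) * sg β n)^s) ≤ A := by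
        refine le_trans ?_ (hsum.sum_le_tsum (range (n+1)) fun s _ => by positivity)
        refine sum_le_sum fun s _ => ?_
        gcongr
      have e2 : (m n : ℝ) * Cconst n (plProb β n) * plProb β n 0 ^ 2 ≤ (Real.log ((n:ℝ)+1))⁻¹ := by
        calc _ ≤ (m n : ℝ) * Cconst n (plProb β n) * (sg β n / Real.log ((n:ℝ)+1)) := by
              gcongr; exact p0_le hβ hn
          _ = (m n : ℝ) * Cconst n (plProb β n) * sg β n * (Real.log ((n:ℝ)+1))⁻¹ := by ring
          _ ≤ 1 * (Real.log ((n:ℝ)+1))⁻¹ := by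
              have := hlam.trans hr1.le
              gcongr
          _ = _ := one_mul _
      rw [mul_comm A]
      exact mul_le_mul e2 e1 (sum_nonneg fun s _ => by positivity) (by positivity)
    · simpa using logn1_top.inv_tendsto_atTop.const_mul A
  have h2 : Tendsto (fun n => 1 - probUnsat2 n (m n) (plProb β n)) atTop (nhds 1) := by
    simpa using hU.const_sub 1
  refine h2.congr' ?_
  filter_upwards [eventually_ge_atTop 1, hsg] with n hn hs
  have := sat_add_unsat (m := m n) (pl_sum hβ hn) (by unfold sg at hs; linarith)
  linarith

lemma exists_k (ε : ℝ) (h0 : 0 < ε) : ∃ k : ℕ → ℕ, Tendsto k atTop atTop ∧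
    (∀ᶠ n : ℕ in atTop, (n:ℝ)^2 ≤ (1 + ε) ^ (k n + 1)) ∧
    Tendsto (fun n : ℕ => ((k n : ℝ) + 1) ^ 28 / n) atTop (nhds 0) ∧
    Tendsto (fun n : ℕ => Real.log ((k n : ℝ) + 1) / Real.log n) atTop (nhds 0) := by
  have hη : 0 < Real.log (1 + ε) := Real.log_pos (by linarith)
  set κ := 2 / Real.log (1 + ε) with hκ
  have hκ0 : 0 < κ := by positivity
  have hkt : Tendsto (fun n : ℕ => ⌈κ * Real.log (n:ℝ)⌉₊) atTop atTop :=
    tendsto_nat_ceil_atTop.comp (logn_top.const_mul_atTop hκ0)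
  have hK1 : Tendsto (fun n : ℕ => ((⌈κ * Real.log (n:ℝ)⌉₊ : ℕ) : ℝ) + 1) atTop atTop :=
    tendsto_atTop_add_const_right _ _ (tendsto_natCast_atTop_atTop.comp hkt)
  have hub : ∀ᶠ n : ℕ in atTop, ((⌈κ * Real.log (n:ℝ)⌉₊ : ℕ) : ℝ) + 1 ≤ (κ + 2) * Real.log n := by
    filter_upwards [logn_top.eventually_ge_atTop 1] with n hn
    have := Nat.ceil_lt_add_one (show 0 ≤ κ * Real.log (n:ℝ) by positivity)
    linarith
  refine ⟨fun n => ⌈κ * Real.log (n:ℝ)⌉₊, hkt, ?_, ?_, ?_⟩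
  · filter_upwards [eventually_ge_atTop 1] with n hn
    have hn' : (0:ℝ) < n := by exact_mod_cast hn
    rw [← Real.log_le_log_iff (by positivity) (by positivity), Real.log_pow, Real.log_pow]
    have := Nat.le_ceil (κ * Real.log (n:ℝ))
    have h3 := mul_le_mul_of_nonneg_right this hη.le
    have e : κ * Real.log (n:ℝ) * Real.log (1 + ε) = 2 * Real.log n := by
      rw [hκ]; field_simp
    rw [e] at h3
    push_cast
    nlinarith
  · have h3 : Tendsto (fun n : ℕ => (κ+2)^28 * (Real.log (n:ℝ) ^ 28 / (n:ℝ))) atTop (nhds 0) := by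
      have := (Real.isLittleO_pow_log_id_atTop (n := 28)).tendsto_div_nhds_zero.comp (tendsto_natCast_atTop_atTop (R := ℝ))
      simpa using this.const_mul ((κ+2)^28)
    refine squeeze_zero' (Eventually.of_forall fun n => by positivity) ?_ h3
    filter_upwards [hub] with n hn
    rw [mul_div_assoc', ← mul_pow]
    gcongr
  · have h3 : Tendsto (fun n : ℕ => (κ+2) * (Real.log (((⌈κ * Real.log (n:ℝ)⌉₊ : ℕ) : ℝ) + 1) / (((⌈κ * Real.log (n:ℝ)⌉₊ : ℕ) : ℝ) + 1))) atTop (nhds 0) := by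
      have := (Real.isLittleO_log_id_atTop).tendsto_div_nhds_zero.comp hK1
      simpa using this.const_mul (κ+2)
    refine squeeze_zero' ?_ ?_ h3
    · filter_upwards with n
      exact div_nonneg (Real.log_nonneg (by linarith [Nat.cast_nonneg (α := ℝ) ⌈κ * Real.log (n:ℝ)⌉₊])) (Real.log_natCast_nonneg n)
    · filter_upwards [hub, logn_top.eventually_gt_atTop 0] with n hn hl
      have h4 : 0 ≤ Real.log (((⌈κ * Real.log (n:ℝ)⌉₊ : ℕ) : ℝ) + 1) := Real.log_nonneg (by linarith [Nat.cast_nonneg (α := ℝ) ⌈κ * Real.log (n:ℝ)⌉₊])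
      rw [mul_div_assoc', div_le_div_iff₀ hl (by positivity)]
      have := mul_le_mul_of_nonneg_left hn h4
      linarith

noncomputable def gB (x : ℝ) : ℝ :=
  (Real.exp (6 * x ^ 10) * (1 + 3 * x)) ^ 2 * (1 + 192 * x ^ 2 * (x ^ 3 + 12) ^ 3)
   + 72 * x ^ 21 * (x ^ 3 + 12) ^ 2 * (Real.exp (6 * x ^ 10) * (1 + 3 * x)) + 2592 * x ^ 12

lemma gB_eq (K : ℝ) (hK : 0 < K) :
    (Real.exp (6 * K ^ 4 / K ^ 14) * (1 + 3 / K)) ^ 2 * (1 + 192 * K ^ 3 * (1 + 12 * K ^ 3) ^ 3 / K ^ 14)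
        + 72 * K * (1 + 12 * K ^ 3) ^ 2 * (Real.exp (6 * K ^ 4 / K ^ 14) * (1 + 3 / K)) / (K ^ 14) ^ 2
        + 2592 * K ^ 2 / K ^ 14 = gB K⁻¹ := by
  unfold gB
  have e1 : 6 * K ^ 4 / K ^ 14 = 6 * K⁻¹ ^ 10 := by field_simp
  have e2 : 192 * K ^ 3 * (1 + 12 * K ^ 3) ^ 3 / K ^ 14 = 192 * K⁻¹ ^ 2 * (K⁻¹ ^ 3 + 12) ^ 3 := by field_simp
  have e3 : ∀ R, 72 * K * (1 + 12 * K ^ 3) ^ 2 * R / (K ^ 14) ^ 2 = 72 * K⁻¹ ^ 21 * (K⁻¹ ^ 3 + 12) ^ 2 * R := by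
    intro R; field_simp
  have e4 : 2592 * K ^ 2 / K ^ 14 = 2592 * K⁻¹ ^ 12 := by field_simp
  rw [e3, e1, e2, e4, div_eq_mul_inv 3 K]

lemma gB_tendsto : Tendsto gB (nhds 0) (nhds 1) := by
  have : Continuous gB := by unfold gB; fun_prop
  exact this.tendsto' 0 1 (by unfold gB; simp)

end thr

section thr2

variable {β : ℝ}

set_option maxHeartbeats 1000000 in
lemma unsat_step (hβ : 3 ≤ β) {n m k L : ℕ} (hL : L = (k+1)^14) (hn : 1 ≤ n) (ε : ℝ)
    (hs : sg β n < 1) (hk : 1 ≤ k) (hm : 1 + ε ≤ (m:ℝ) * sg β n)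
    (hkn : ((k:ℝ) + 1) ^ 28 ≤ n) (hkm : 4 * ((k:ℝ) + 1) ^ 2 ≤ m) (hε0 : 0 < ε)
    (hH : 2 ≤ HH n) (hHL : HH L ≤ HH n / 2)
    (hH2 : (1 + ε/2) * HH n ≤ (1 + ε) * (HH n - HH L))
    (hk2 : 2 / ((k:ℝ)+1) ≤ ε/2) (hpow : (n:ℝ)^2 ≤ (1 + ε/2) ^ (k+1)) :
    (1 - 4 * ((k:ℝ)+1) ^ 2 / m) * (1 - 4 * ((k:ℝ)+1)⁻¹ ^ 12) ≤ gB ((k:ℝ)+1)⁻¹ * probUnsat2 n m (plProb β n) := by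
  have hk' : (1:ℝ) ≤ k := by exact_mod_cast hk
  have hn' : (1:ℝ) ≤ n := by exact_mod_cast hn
  set K : ℝ := (k:ℝ) + 1 with hK
  have hK0 : 0 < K := by linarith
  have hK2 : 2 ≤ K := by linarith
  have hLr : K ^ 14 = (L:ℝ) := by rw [hL, hK]; push_cast; ring
  have hL2 : 2 * L ≤ n := by
    have h3 : 2 * K ^ 14 ≤ n := by
      refine le_trans ?_ hkn
      have : (2:ℝ) ≤ K ^ 14 := by
        calc (2:ℝ) ≤ K := hK2
          _ ≤ K ^ 14 := le_self_pow₀ (by linarith) (by norm_num)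
      calc 2 * K ^ 14 ≤ K ^ 14 * K ^ 14 := by gcongr
        _ = _ := by ring
    rw [hLr] at h3
    exact_mod_cast h3
  have hL0 : 1 ≤ L := by rw [hL]; exact Nat.one_le_pow _ _ (by omega)
  have hLn : L ≤ n := by omega
  set p := plProb β n with hp
  set V := ∑ i ∈ Ico L n, p i ^ 2 with hV
  have hσ := sg_pos hβ hn
  have hC : 1 ≤ Cconst n p := by
    unfold Cconst
    apply (one_le_inv₀ _).mpr
    · change 1 - sg β n ≤ 1; linarith
    · change 0 < 1 - sg β n; linarith
  have hV0 : 0 ≤ V := sum_nonneg fun i _ => by positivity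
  have hVs : (1 + ε/2) ≤ (m:ℝ) * V := by
    have h3 := tail_ratio hβ hn hLn
    have h4 : (1 + ε/2) * HH n ≤ (m:ℝ) * V * HH n := by
      calc _ ≤ _ := hH2
        _ ≤ (m:ℝ) * sg β n * (HH n - HH L) := by
            refine mul_le_mul_of_nonneg_right hm ?_
            linarith
        _ = m * (sg β n * (HH n - HH L)) := by ring
        _ ≤ m * (HH n * V) := by gcongr
        _ = _ := by ring
    exact le_of_mul_le_mul_right h4 (by linarith)
  have hl : 1 + ε/2 ≤ (m:ℝ) * Cconst n p / 2 * (2 * V) := by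
    refine hVs.trans ?_
    have : (m:ℝ) * V * 1 ≤ m * V * Cconst n p := by gcongr
    linarith
  have key := unsat_num (n := n) (m := m) (k := k) (p := p) hn (fun i _ => (pl_pos hβ hn i).le)
    (pl_sum hβ hn) hs L hk (p L) (2 * V) (2 * ∑ i ∈ Ico L n, p i ^ 4) K ((m:ℝ) * Cconst n p / 2 * (2 * V)) (K ^ 14)
    (pl_pos hβ hn L).le (by
      intro a
      unfold pt
      split_ifs with h
      · exact pl_anti hβ hn h
      · exact (pl_pos hβ hn L).le)
    (pt_sum L 2 (by norm_num) p).symm (pt_sum L 4 (by norm_num) p).symm hK rfl hLr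
    (by
      rw [hLr]
      have h3 := tail_ge hβ hn hLn
      have h4 : p L ^ 2 * (L+1) * 1 ≤ p L ^ 2 * (L+1) * (HH n - HH L) := by
        refine mul_le_mul_of_nonneg_left ?_ (by positivity)
        linarith
      have h5 : 0 ≤ p L ^ 2 := by positivity
      linarith)
    (by
      rw [hLr]
      have h3 := tail4 hβ hn hL2
      have h5 : 0 ≤ ∑ i ∈ Ico L n, p i ^ 4 := sum_nonneg fun i _ => by positivity
      linarith)
    (by
      have h3 : (∑ i ∈ Ico L n, p i ^ 2) ^ 2 ≤ (#(Ico L n) : ℝ) * ∑ i ∈ Ico L n, (p i ^ 2) ^ 2 := sq_sum_le_card_mul_sum_sq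
      have h4 : (#(Ico L n) : ℝ) ≤ n := by
        rw [Nat.card_Ico]; exact_mod_cast Nat.sub_le _ _
      have h5 : ∀ i, (p i ^ 2) ^ 2 = p i ^ 4 := fun i => by ring
      simp only [h5] at h3
      have h6 : 0 ≤ ∑ i ∈ Ico L n, p i ^ 4 := sum_nonneg fun i _ => by positivity
      have h7 := mul_le_mul_of_nonneg_right h4 h6
      rw [mul_pow]
      linarith)
    (by
      have : 0 < ∑ i ∈ Ico L n, p i ^ 4 := sum_pos (fun i _ => by
        have := pl_pos hβ hn i
        rw [hp]; positivity) ⟨L, mem_Ico.mpr ⟨le_rfl, by omega⟩⟩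
      linarith)
    (by linarith)
    (by
      calc (n:ℝ) * K ^ 14 ≤ n * n := by
            rw [hLr]; gcongr
        _ = (n:ℝ)^2 := by ring
        _ ≤ _ := hpow
        _ ≤ _ := pow_le_pow_left₀ (by positivity) hl _)
    (by
      have : (4:ℝ) ≤ K ^ 12 := by
        calc (4:ℝ) ≤ 2 ^ 12 := by norm_num
          _ ≤ K ^ 12 := by gcongr
      calc 4 * K ^ 2 ≤ K ^ 12 * K ^ 2 := by gcongr
        _ = _ := by ring)
    (by
      have h3 : 2 * K ≤ m := by
        have h8 : 2 * K ≤ K * K := mul_le_mul_of_nonneg_right hK2 hK0.le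
        have h9 : 0 ≤ K * K := by positivity
        rw [pow_two] at hkm
        linarith
      rw [hK] at h3
      exact_mod_cast h3)
  rw [gB_eq K hK0] at key
  have e : 4 * K ^ 2 / K ^ 14 = 4 * K⁻¹ ^ 12 := by field_simp
  rwa [e] at key

lemma unsat_whp (hβ : 3 ≤ β) (m : ℕ → ℕ) (ε : ℝ) (h0 : 0 < ε)
    (h : ∀ᶠ n in atTop, 1 + ε ≤ (m n : ℝ) * sg β n) :
    Tendsto (fun n => probSat2 n (m n) (plProb β n)) atTop (nhds 0) := by
  obtain ⟨k, hk1, hk2, hk3, hk4⟩ := exists_k (ε/2) (by linarith)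
  have hK : Tendsto (fun n => (k n : ℝ) + 1) atTop atTop :=
    tendsto_atTop_add_const_right _ _ (tendsto_natCast_atTop_atTop.comp hk1)
  have hKi : Tendsto (fun n => ((k n : ℝ) + 1)⁻¹) atTop (nhds 0) := hK.inv_tendsto_atTop
  have hsg := (sg_tendsto hβ).eventually (gt_mem_nhds (show (0:ℝ) < 1 by norm_num))
  have hHtop : Tendsto HH atTop atTop := tendsto_atTop_mono HH_ge logn1_top
  have hratio : Tendsto (fun n => HH ((k n + 1)^14) / HH n) atTop (nhds 0) := by
    have h3 : Tendsto (fun n : ℕ => (Real.log (n:ℝ))⁻¹ + 14 * (Real.log ((k n : ℝ) + 1) / Real.log n)) atTop (nhds 0) := by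
      simpa using logn_top.inv_tendsto_atTop.add (hk4.const_mul 14)
    refine squeeze_zero' ?_ ?_ h3
    · filter_upwards with n
      unfold HH
      exact div_nonneg (sum_nonneg fun i _ => by positivity) (sum_nonneg fun i _ => by positivity)
    · filter_upwards [logn_top.eventually_gt_atTop 0, eventually_ge_atTop 1] with n hn h1
      have h4 := HH_le ((k n + 1)^14)
      push_cast at h4
      rw [Real.log_pow] at h4
      have h5 : Real.log n ≤ HH n := le_trans (Real.log_le_log (by exact_mod_cast h1) (by linarith)) (HH_ge n)
      have h6 : 0 ≤ HH ((k n + 1)^14) := by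
        unfold HH; exact sum_nonneg fun i _ => by positivity
      calc _ ≤ HH ((k n + 1)^14) / Real.log n := div_le_div_of_nonneg_left h6 hn h5
        _ ≤ (1 + (14:ℕ) * Real.log ((k n : ℝ) + 1)) / Real.log n := by gcongr
        _ = _ := by push_cast; ring
  have hKm : Tendsto (fun n => 4 * ((k n : ℝ) + 1) ^ 2 / (m n : ℝ)) atTop (nhds 0) := by
    have h3 : Tendsto (fun n : ℕ => 4 * √(((k n : ℝ) + 1) ^ 28 / n)) atTop (nhds 0) := by
      have := (Real.continuous_sqrt.tendsto 0).comp hk3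
      rw [Real.sqrt_zero] at this
      simpa using this.const_mul 4
    refine squeeze_zero' (Eventually.of_forall fun n => by positivity) ?_ h3
    filter_upwards [h, eventually_ge_atTop 1] with n hm hn
    have hn' : (0:ℝ) < n := by exact_mod_cast hn
    have h4 : √(n:ℝ) ≤ m n := by
      have h5 := mul_le_mul_of_nonneg_left (sg_le hβ hn) (Nat.cast_nonneg (α := ℝ) (m n))
      have h6 : 1 ≤ (m n : ℝ) * (1 / √n) := by linarith
      rwa [mul_one_div, one_le_div (Real.sqrt_pos.mpr hn')] at h6
    have h7 : √(((k n : ℝ) + 1) ^ 28 / n) = ((k n : ℝ) + 1) ^ 14 / √n := by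
      rw [Real.sqrt_div' _ hn'.le, show ((k n : ℝ) + 1) ^ 28 = (((k n : ℝ) + 1) ^ 14)^2 by ring, Real.sqrt_sq (by positivity)]
    rw [h7, mul_div_assoc]
    have h8 : ((k n : ℝ) + 1) ^ 2 ≤ ((k n : ℝ) + 1) ^ 14 :=
      pow_le_pow_right₀ (by linarith [Nat.cast_nonneg (α := ℝ) (k n)]) (by norm_num)
    have h9 := Real.sqrt_pos.mpr hn'
    gcongr
  have hB : Tendsto (fun n => gB ((k n : ℝ) + 1)⁻¹) atTop (nhds 1) := gB_tendsto.comp hKi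
  have hA : Tendsto (fun n => (1 - 4 * ((k n:ℝ)+1) ^ 2 / (m n : ℝ)) * (1 - 4 * ((k n:ℝ)+1)⁻¹ ^ 12)) atTop (nhds 1) := by
    have h3 := (hKm.const_sub 1).mul (((hKi.pow 12).const_mul 4).const_sub 1)
    simpa using h3
  have hBA : Tendsto (fun n => 2 * (gB ((k n : ℝ) + 1)⁻¹ - (1 - 4 * ((k n:ℝ)+1) ^ 2 / (m n : ℝ)) * (1 - 4 * ((k n:ℝ)+1)⁻¹ ^ 12))) atTop (nhds 0) := by
    simpa using (hB.sub hA).const_mul 2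
  refine squeeze_zero' ?_ ?_ hBA
  · filter_upwards [eventually_ge_atTop 1, hsg] with n hn hs
    exact probSat_nonneg (fun i _ => (pl_pos hβ hn i).le) hs
  · have hδ : 0 < min (1/2) (ε/2/(1+ε)) := by positivity
    filter_upwards [eventually_ge_atTop 1, hsg, h, hk2, hk1.eventually_ge_atTop 1,
      hk3.eventually (gt_mem_nhds (show (0:ℝ) < 1 by norm_num)),
      hKm.eventually (gt_mem_nhds (show (0:ℝ) < 1 by norm_num)),
      hHtop.eventually_ge_atTop 2, hratio.eventually (gt_mem_nhds hδ),
      hKi.eventually (gt_mem_nhds (show 0 < ε/4 by linarith)),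
      hB.eventually (lt_mem_nhds (show (1/2:ℝ) < 1 by norm_num))] with n hn hs hm hp hk hkn hkm hH hr hKe hB2
    have hn' : (0:ℝ) < n := by exact_mod_cast hn
    have hm0 : (0:ℝ) < m n := by
      rcases (Nat.cast_nonneg (α := ℝ) (m n)).eq_or_lt with h5 | h5
      · rw [← h5, zero_mul] at hm; linarith
      · exact h5
    have hH0 : 0 < HH n := by linarith
    rw [div_lt_iff₀ hH0] at hr
    have hr1 := hr.le.trans (mul_le_mul_of_nonneg_right (min_le_left _ _) hH0.le)
    have hr2 := hr.le.trans (mul_le_mul_of_nonneg_right (min_le_right _ _) hH0.le)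
    have h1e : 0 < 1 + ε := by linarith
    have key := unsat_step hβ rfl hn ε hs hk hm (by rw [div_lt_one hn'] at hkn; exact hkn.le)
      (by rw [div_lt_one hm0] at hkm; exact hkm.le) h0 hH (by linarith)
      (by
        have h6 := mul_le_mul_of_nonneg_left hr2 h1e.le
        have e : (1 + ε) * (ε/2/(1+ε) * HH n) = ε/2 * HH n := by field_simp
        rw [e] at h6
        linarith) (by rw [div_eq_mul_inv]; linarith) hp
    have hadd := sat_add_unsat (m := m n) (pl_sum hβ hn) hs
    have hS := probSat_nonneg (m := m n) (fun i _ => (pl_pos hβ hn i).le) hs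
    have e : probUnsat2 n (m n) (plProb β n) = 1 - probSat2 n (m n) (plProb β n) := by linarith
    rw [e] at key
    have := mul_le_mul_of_nonneg_right hB2.le hS
    linarith

end thr2

section asym

variable {β : ℝ}

noncomputable def TT (s : ℝ) (n : ℕ) : ℝ := ∑ j ∈ range n, ((n:ℝ) / (j+1)) ^ s

lemma step_up (s : ℝ) (h0 : 0 < s) (h1 : s < 1) (j : ℕ) :
    ((j:ℝ)+1+1) ^ (1-s) - ((j:ℝ)+1) ^ (1-s) ≤ (1-s) * ((j:ℝ)+1) ^ (-s) := by
  have hj : (0:ℝ) < (j:ℝ)+1 := by positivity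
  have e : (j:ℝ)+1+1 = (j+1) * (1 + 1/((j:ℝ)+1)) := by field_simp
  have e2 : ((j:ℝ)+1) ^ (1-s) = ((j:ℝ)+1) * ((j:ℝ)+1) ^ (-s) := by
    rw [sub_eq_add_neg, Real.rpow_add hj, Real.rpow_one]
  have h2 := _root_.rpow_one_add_le_one_add_mul_self (s := 1/((j:ℝ)+1)) (p := 1-s)
    (by have : 0 ≤ 1/((j:ℝ)+1) := by positivity
        linarith) (by linarith) (by linarith)
  rw [e, Real.mul_rpow hj.le (by positivity)]
  have h3 := mul_le_mul_of_nonneg_left h2 (show 0 ≤ ((j:ℝ)+1) ^ (1-s) by positivity)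
  have e3 : ((j:ℝ)+1) ^ (1-s) * (1 + (1-s) * (1/((j:ℝ)+1))) = ((j:ℝ)+1) ^ (1-s) + (1-s) * ((j:ℝ)+1) ^ (-s) := by
    rw [e2]; field_simp
  rw [e3] at h3
  linarith

lemma step_down (s : ℝ) (h0 : 0 < s) (h1 : s < 1) (j : ℕ) :
    (1-s) * ((j:ℝ)+1) ^ (-s) ≤ ((j:ℝ)+1) ^ (1-s) - (j:ℝ) ^ (1-s) := by
  have hj : (0:ℝ) < (j:ℝ)+1 := by positivity
  have e : (j:ℝ) = (j+1) * (1 + -(1/((j:ℝ)+1))) := by field_simp; ring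
  have e2 : ((j:ℝ)+1) ^ (1-s) = ((j:ℝ)+1) * ((j:ℝ)+1) ^ (-s) := by
    rw [sub_eq_add_neg, Real.rpow_add hj, Real.rpow_one]
  have h4 : 1/((j:ℝ)+1) ≤ 1 := by
    rw [div_le_one hj]; linarith [Nat.cast_nonneg (α := ℝ) j]
  have h2 := _root_.rpow_one_add_le_one_add_mul_self (s := -(1/((j:ℝ)+1))) (p := 1-s)
    (by linarith) (by linarith) (by linarith)
  have h3 := mul_le_mul_of_nonneg_left h2 (show 0 ≤ ((j:ℝ)+1) ^ (1-s) by positivity)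
  rw [← Real.mul_rpow hj.le (by linarith), ← e] at h3
  have e3 : ((j:ℝ)+1) ^ (1-s) * (1 + (1-s) * -(1/((j:ℝ)+1))) = ((j:ℝ)+1) ^ (1-s) - (1-s) * ((j:ℝ)+1) ^ (-s) := by
    rw [e2]; field_simp; ring
  rw [e3] at h3
  linarith

lemma sum_up (s : ℝ) (h0 : 0 < s) (h1 : s < 1) (n : ℕ) :
    (1-s) * ∑ j ∈ range n, ((j:ℝ)+1) ^ (-s) ≤ (n:ℝ) ^ (1-s) := by
  rw [mul_sum]
  calc _ ≤ ∑ j ∈ range n, ((((j+1:ℕ):ℝ)) ^ (1-s) - (j:ℝ) ^ (1-s)) := by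
        refine sum_le_sum fun j _ => ?_
        push_cast
        exact step_down s h0 h1 j
    _ = _ := by
        rw [sum_range_sub (fun j : ℕ => (j:ℝ) ^ (1-s))]
        rw [Nat.cast_zero, Real.zero_rpow (by linarith), sub_zero]

lemma sum_dn (s : ℝ) (h0 : 0 < s) (h1 : s < 1) (n : ℕ) :
    (n:ℝ) ^ (1-s) - 1 ≤ (1-s) * ∑ j ∈ range n, ((j:ℝ)+1) ^ (-s) := by
  rw [mul_sum]
  calc (n:ℝ) ^ (1-s) - 1 ≤ ((n:ℝ)+1) ^ (1-s) - 1 := by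
        have : (n:ℝ) ^ (1-s) ≤ ((n:ℝ)+1) ^ (1-s) :=
          Real.rpow_le_rpow (by positivity) (by linarith) (by linarith)
        linarith
    _ = ∑ j ∈ range n, ((((j+1:ℕ):ℝ)+1) ^ (1-s) - ((j:ℝ)+1) ^ (1-s)) := by
        rw [sum_range_sub (fun j : ℕ => ((j:ℝ)+1) ^ (1-s))]
        rw [Nat.cast_zero, zero_add, Real.one_rpow]
    _ ≤ _ := by
        refine sum_le_sum fun j _ => ?_
        push_cast
        exact step_up s h0 h1 j

lemma TT_tendsto (s : ℝ) (h0 : 0 < s) (h1 : s < 1) :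
    Tendsto (fun n : ℕ => TT s n / n) atTop (nhds (1 / (1-s))) := by
  have h1' : 0 < 1 - s := by linarith
  have hpow : Tendsto (fun n : ℕ => ((n:ℝ) ^ (1-s))⁻¹) atTop (nhds 0) :=
    ((tendsto_rpow_atTop h1').comp tendsto_natCast_atTop_atTop).inv_tendsto_atTop
  have e : ∀ n : ℕ, 1 ≤ n → TT s n / n = (∑ j ∈ range n, ((j:ℝ)+1) ^ (-s)) * ((n:ℝ) ^ (1-s))⁻¹ := by
    intro n hn
    have hn' : (0:ℝ) < n := by exact_mod_cast hn
    have e2 : TT s n = (n:ℝ) ^ s * ∑ j ∈ range n, ((j:ℝ)+1) ^ (-s) := by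
      unfold TT
      rw [mul_sum]
      refine sum_congr rfl fun j _ => ?_
      rw [Real.div_rpow hn'.le (by positivity), Real.rpow_neg (by positivity)]
      rfl
    rw [e2, Real.rpow_sub hn', Real.rpow_one]
    have : 0 < (n:ℝ) ^ s := by positivity
    field_simp
  refine tendsto_of_tendsto_of_tendsto_of_le_of_le' (g := fun n : ℕ => (1 - ((n:ℝ) ^ (1-s))⁻¹) / (1-s)) (h := fun _ => 1 / (1-s)) ?_ tendsto_const_nhds ?_ ?_
  · simpa using (hpow.const_sub 1).div_const (1-s)
  · filter_upwards [eventually_ge_atTop 1] with n hn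
    have hn' : (0:ℝ) < (n:ℝ) ^ (1-s) := Real.rpow_pos_of_pos (by exact_mod_cast hn) _
    rw [e n hn, div_le_iff₀ h1', ← mul_le_mul_iff_left₀ hn']
    have := sum_dn s h0 h1 n
    field_simp
    linarith
  · filter_upwards [eventually_ge_atTop 1] with n hn
    have hn' : (0:ℝ) < (n:ℝ) ^ (1-s) := Real.rpow_pos_of_pos (by exact_mod_cast hn) _
    rw [e n hn, le_div_iff₀ h1', ← mul_le_mul_iff_left₀ hn']
    have := sum_up s h0 h1 n
    field_simp
    linarith

lemma sg_eq (β : ℝ) (n : ℕ) : sg β n = TT (2 * (1 / (β-1))) n / TT (1/(β-1)) n ^ 2 := by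
  unfold sg plProb
  change ∑ i ∈ range n, (_ / TT (1/(β-1)) n) ^ 2 = _
  simp only [div_pow]
  rw [← sum_div]
  congr 1
  unfold TT
  refine sum_congr rfl fun j _ => ?_
  rw [mul_comm 2, Real.rpow_mul (by positivity), ← Real.rpow_natCast]
  norm_num

lemma scale_gt (hβ : 3 < β) :
    Tendsto (fun n : ℕ => (β - 3) * (β - 1) / (β - 2) ^ 2 * n * sg β n) atTop (nhds 1) := by
  have ha := a_pos hβ.le
  have ha2 : 1 / (β-1) < 1/2 := by apply one_div_lt_one_div_of_lt <;> linarith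
  have hA := TT_tendsto (1/(β-1)) ha (by linarith)
  have hB := TT_tendsto (2*(1/(β-1))) (by linarith) (by linarith)
  have h1 : (1:ℝ) / (1 - 1/(β-1)) ≠ 0 := by
    have : 0 < 1 - 1/(β-1) := by linarith
    positivity
  have h := (hB.div (hA.pow 2) (pow_ne_zero 2 h1)).const_mul ((β - 3) * (β - 1) / (β - 2) ^ 2)
  have e : (β - 3) * (β - 1) / (β - 2) ^ 2 * (1 / (1 - 2 * (1 / (β - 1))) / (1 / (1 - 1 / (β - 1))) ^ 2) = 1 := by
    have h1 : β - 1 ≠ 0 := by linarith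
    have h2 : β - 2 ≠ 0 := by linarith
    have h3 : β - 3 ≠ 0 := by linarith
    have e1 : 1 - 2 * (1 / (β - 1)) = (β - 3)/(β-1) := by field_simp; ring
    have e2 : 1 - (1 / (β - 1)) = (β - 2)/(β-1) := by field_simp; ring
    rw [e1, e2]
    field_simp
  rw [e] at h
  refine h.congr' ?_
  filter_upwards [eventually_ge_atTop 1] with n hn
  have hn' : (n:ℝ) ≠ 0 := by
    have : (0:ℝ) < n := by exact_mod_cast hn
    exact this.ne'
  rw [sg_eq]
  have : TT (1/(β-1)) n ≠ 0 := (plSum_pos hβ.le hn).ne'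
  simp only [Pi.div_apply, Pi.pow_apply]
  field_simp

lemma HH_div : Tendsto (fun n : ℕ => HH n / Real.log n) atTop (nhds 1) := by
  refine tendsto_of_tendsto_of_tendsto_of_le_of_le' (g := fun _ => 1) (h := fun n : ℕ => (Real.log (n:ℝ))⁻¹ + 1) tendsto_const_nhds ?_ ?_ ?_
  · simpa using logn_top.inv_tendsto_atTop.add_const 1
  · filter_upwards [logn_top.eventually_gt_atTop 0, eventually_ge_atTop 1] with n hn h1
    rw [le_div_iff₀ hn, one_mul]
    exact le_trans (Real.log_le_log (by exact_mod_cast h1) (by linarith)) (HH_ge n)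
  · filter_upwards [logn_top.eventually_gt_atTop 0] with n hn
    rw [div_le_iff₀ hn, add_mul, inv_mul_cancel₀ hn.ne', one_mul]
    exact HH_le n

lemma scale_eq :
    Tendsto (fun n : ℕ => 4 * (n:ℝ) / Real.log n * sg 3 n) atTop (nhds 1) := by
  have hA := TT_tendsto (1/(3-1)) (by norm_num) (by norm_num)
  have h := (HH_div.div (hA.pow 2) (by norm_num)).const_mul 4
  have e : (4:ℝ) * (1 / (1 / (1 - 1/(3-1))) ^ 2) = 1 := by norm_num
  rw [e] at h
  refine h.congr' ?_
  filter_upwards [eventually_ge_atTop 1, logn_top.eventually_gt_atTop 0] with n hn hl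
  have hn' : (0:ℝ) < n := by exact_mod_cast hn
  rw [sg_eq]
  have h3 : TT (1/(3-1)) n ≠ 0 := (plSum_pos (β := 3) le_rfl hn).ne'
  have h4 : TT (2 * (1/(3-1))) n = n * HH n := by
    unfold TT HH
    rw [mul_sum]
    refine sum_congr rfl fun j _ => ?_
    norm_num
    rfl
  rw [h4]
  simp only [Pi.div_apply, Pi.pow_apply]
  field_simp

lemma thr_sat (hβ : 3 ≤ β) (M : ℕ → ℝ) (hM : Tendsto (fun n => M n * sg β n) atTop (nhds 1))
    (ε : ℝ) (h0 : 0 < ε) (m : ℕ → ℕ) (h : ∀ᶠ n in atTop, (m n : ℝ) ≤ (1 - ε) * M n) :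
    Tendsto (fun n => probSat2 n (m n) (plProb β n)) atTop (nhds 1) := by
  set e := min ε (1/2) with he
  have he0 : 0 < e := by positivity
  have he1 : e ≤ 1/2 := min_le_right _ _
  have he2 : e ≤ ε := min_le_left _ _
  refine sat_whp hβ m (e/2) (by linarith) (by linarith) ?_
  filter_upwards [h, eventually_ge_atTop 1, hM.eventually (gt_mem_nhds (show 1 < 1 + e/2 by linarith)),
    hM.eventually (lt_mem_nhds (show (0:ℝ) < 1 by norm_num))] with n hm hn h1 h2
  have h3 := mul_le_mul_of_nonneg_right hm (sg_pos hβ hn).le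
  rw [mul_assoc] at h3
  have h4 : (1 - ε) * (M n * sg β n) ≤ (1 - e) * (M n * sg β n) :=
    mul_le_mul_of_nonneg_right (by linarith) h2.le
  have h5 : (1 - e) * (M n * sg β n) ≤ (1 - e) * (1 + e/2) :=
    mul_le_mul_of_nonneg_left h1.le (by linarith)
  nlinarith

lemma thr_unsat (hβ : 3 ≤ β) (M : ℕ → ℝ) (hM : Tendsto (fun n => M n * sg β n) atTop (nhds 1))
    (ε : ℝ) (h0 : 0 < ε) (m : ℕ → ℕ) (h : ∀ᶠ n in atTop, (1 + ε) * M n ≤ (m n : ℝ)) :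
    Tendsto (fun n => probSat2 n (m n) (plProb β n)) atTop (nhds 0) := by
  refine unsat_whp hβ m (ε/2) (by linarith) ?_
  have h6 : (1 + ε/2) / (1 + ε) < 1 := by rw [div_lt_one (by linarith)]; linarith
  filter_upwards [h, eventually_ge_atTop 1, hM.eventually (lt_mem_nhds h6)] with n hm hn h1
  have h3 := mul_le_mul_of_nonneg_right hm (sg_pos hβ hn).le
  rw [mul_assoc] at h3
  rw [div_lt_iff₀' (by linarith)] at h1
  linarith

end asym

/-- Power-law random 2-SAT with exponent `β ≥ 3` satisfies `p₁² = o(∑ pᵢ²)` and has a sharp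
satisfiability threshold, located at `((β-3)(β-1)/(β-2)²)·n` for `β > 3` and at
`4n/ln n` for `β = 3`. -/
theorem powerlaw_2SAT_sharp_threshold (β : ℝ) (hβ : 3 ≤ β) :
    ((fun n => plProb β n 0 ^ 2) =o[atTop] fun n => ∑ i ∈ Finset.range n, plProb β n i ^ 2) ∧
    (∀ ε : ℝ, 0 < ε →
      (3 < β →
        (∀ m : ℕ → ℕ,
          (∀ᶠ n in atTop, (m n : ℝ) ≤ (1 - ε) * ((β - 3) * (β - 1) / (β - 2) ^ 2 * n)) →
          Tendsto (fun n => probSat2 n (m n) (plProb β n)) atTop (nhds 1)) ∧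
        (∀ m : ℕ → ℕ,
          (∀ᶠ n : ℕ in atTop, (1 + ε) * ((β - 3) * (β - 1) / (β - 2) ^ 2 * n) ≤ (m n : ℝ)) →
          Tendsto (fun n => probSat2 n (m n) (plProb β n)) atTop (nhds 0))) ∧
      (β = 3 →
        (∀ m : ℕ → ℕ,
          (∀ᶠ n in atTop, (m n : ℝ) ≤ (1 - ε) * (4 * (n : ℝ) / Real.log n)) →
          Tendsto (fun n => probSat2 n (m n) (plProb β n)) atTop (nhds 1)) ∧
        (∀ m : ℕ → ℕ,
          (∀ᶠ n : ℕ in atTop, (1 + ε) * (4 * (n : ℝ) / Real.log n) ≤ (m n : ℝ)) →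
          Tendsto (fun n => probSat2 n (m n) (plProb β n)) atTop (nhds 0)))) := by
  refine ⟨first_part hβ, fun ε h0 => ⟨fun h3 => ⟨fun m hm => ?_, fun m hm => ?_⟩, fun h3 => ?_⟩⟩
  · exact thr_sat hβ _ (scale_gt h3) ε h0 m hm
  · exact thr_unsat hβ _ (scale_gt h3) ε h0 m hm
  · subst h3
    exact ⟨fun m hm => thr_sat hβ _ scale_eq ε h0 m hm, fun m hm => thr_unsat hβ _ scale_eq ε h0 m hm⟩
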